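/- Let q be a 2way-determined query that admits a triangle-tripath. Then for every integer k ≥ 1 there exists a database D such that D ⊨ certain(q) but ∅ ∉ Δ_k(q,D); in particular, for every k the greedy fixpoint algorithm does not compute certain(q). -/

import Mathlib

/- Consistent query answering framework: a single relation symbol of arity `n`
   whose first `l` positions form the primary key. Facts are `Fin n → Elem`,
   atoms are `Fin n → Var`. -/

namespace CQA

/-- Key-equality: the tuples of the first `l` entries coincide. -/
def keyEq (l : ℕ) {n : ℕ} {α : Type*} (s t : Fin n → α) : Prop :=
  ∀ i : Fin n, (i : ℕ) < l → s i = t i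

/-- The set of entries occurring in the first `l` (key) positions of a tuple. -/
def keySet (l : ℕ) {n : ℕ} {α : Type*} (t : Fin n → α) : Set α :=
  {x | ∃ i : Fin n, (i : ℕ) < l ∧ t i = x}

/-- The set of all entries of a tuple. -/
def varsSet {n : ℕ} {α : Type*} (t : Fin n → α) : Set α :=
  Set.range t

/-- A (two-atom, Boolean, self-join) query `q = AB` is a pair of atoms. -/
abbrev Query (n : ℕ) (Var : Type*) := (Fin n → Var) × (Fin n → Var)

variable {n : ℕ} {Elem Var : Type*}

/-- The pair of facts `(a, b)` matches the two atoms of `q` via a single assignment `μ`. -/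
def solPair (q : Query n Var) (a b : Fin n → Elem) : Prop :=
  ∃ μ : Var → Elem, (∀ i, μ (q.1 i) = a i) ∧ (∀ i, μ (q.2 i) = b i)

/-- `D ⊨ q(ab)` : `(a,b)` is a solution to `q` in `D`. -/
def Sol (q : Query n Var) (D : Set (Fin n → Elem)) (a b : Fin n → Elem) : Prop :=
  a ∈ D ∧ b ∈ D ∧ solPair q a b

/-- `D ⊨ q{ab}` : `(a,b)` or `(b,a)` is a solution to `q` in `D`. -/
def SolSym (q : Query n Var) (D : Set (Fin n → Elem)) (a b : Fin n → Elem) : Prop :=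
  Sol q D a b ∨ Sol q D b a

/-- The set `q(D)` of solutions to `q` in `D`. -/
def solSet (q : Query n Var) (D : Set (Fin n → Elem)) :
    Set ((Fin n → Elem) × (Fin n → Elem)) :=
  {p | Sol q D p.1 p.2}

/-- `D ⊨ q` : some solution to `q` exists in `D`. -/
def Sat (q : Query n Var) (D : Set (Fin n → Elem)) : Prop :=
  ∃ a b, Sol q D a b

/-- A database is consistent if it contains no two distinct key-equal facts. -/
def Consistent (l : ℕ) (D : Set (Fin n → Elem)) : Prop :=
  ∀ a ∈ D, ∀ b ∈ D, keyEq l a b → a = b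

/-- `r` is a repair of `D` : a maximal consistent subset of `D`. -/
def Repair (l : ℕ) (D r : Set (Fin n → Elem)) : Prop :=
  r ⊆ D ∧ Consistent l r ∧ ∀ s, r ⊆ s → s ⊆ D → Consistent l s → s = r

/-- `D ⊨ certain(q)` : all repairs of `D` satisfy `q`. -/
def Certain (l : ℕ) (q : Query n Var) (D : Set (Fin n → Elem)) : Prop :=
  ∀ r, Repair l D r → Sat q r

/-- The block of the fact `a` in `D`: all facts of `D` key-equal to `a`. -/
def Block (l : ℕ) (D : Set (Fin n → Elem)) (a : Fin n → Elem) : Set (Fin n → Elem) :=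
  {b ∈ D | keyEq l a b}

/-- A `k`-set of `D`: at most `k` facts of `D`, at most one from each block. -/
def kSet (l k : ℕ) (D S : Set (Fin n → Elem)) : Prop :=
  S ⊆ D ∧ S.Finite ∧ S.ncard ≤ k ∧ Consistent l S

/-- A collection `𝒮` of sets of facts is closed under the two rules defining `Δ_k(q,D)`:
  (i) every `k`-set satisfying `q` is in `𝒮`, and (ii) if for a `k`-set `S` there is
  a block of `D` each of whose facts `u` admits a subset `S' ⊆ S ∪ {u}` that is a
  `k`-set belonging to `𝒮`, then `S ∈ 𝒮`. -/
def DeltaClosed (l k : ℕ) (q : Query n Var) (D : Set (Fin n → Elem))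
    (𝒮 : Set (Set (Fin n → Elem))) : Prop :=
  (∀ S, kSet l k D S → Sat q S → S ∈ 𝒮) ∧
  (∀ S, kSet l k D S → (∃ x ∈ D, ∀ u ∈ D, keyEq l x u →
      ∃ S', S' ⊆ S ∪ {u} ∧ kSet l k D S' ∧ S' ∈ 𝒮) → S ∈ 𝒮)

/-- `Δ_k(q,D)`: the least collection of `k`-sets of `D` closed under the two rules
(the intersection of all closed collections). -/
def Delta (l k : ℕ) (q : Query n Var) (D : Set (Fin n → Elem)) :
    Set (Set (Fin n → Elem)) :=
  ⋂₀ {𝒮 | DeltaClosed l k q D 𝒮}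

/-- `q = AB` is 2way-determined. -/
def TwoWayDet (l : ℕ) (q : Query n Var) : Prop :=
  ¬ keySet l q.1 ⊆ keySet l q.2 ∧ ¬ keySet l q.2 ⊆ keySet l q.1 ∧
  keySet l q.1 ⊆ varsSet q.2 ∧ keySet l q.2 ⊆ varsSet q.1

/-- The zig-zag property of a query `q`, relative to databases over `Elem`. -/
def ZigZag (l : ℕ) (q : Query n Var) (Elem : Type*) : Prop :=
  ∀ D : Set (Fin n → Elem), D.Finite →
    ∀ a b b' c : Fin n → Elem, a ∈ D → b ∈ D → b' ∈ D → c ∈ D →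
      ¬ keyEq l a c → a ≠ b → keyEq l b b' →
      Sol q D a b → Sol q D c b' → Sol q D a b'

/-- `rkey(a, r)`: facts of `r` whose key entries are included in those of `a`. -/
def rkey (l : ℕ) (r : Set (Fin n → Elem)) (a : Fin n → Elem) : Set (Fin n → Elem) :=
  {c ∈ r | keySet l c ⊆ keySet l a}

open Classical in
/-- `g(e)`, the set of entries of the tuple `g̅(e)`, for `e` branching with `d, f`. -/
noncomputable def gSet (l : ℕ) (d e f : Fin n → Elem) : Set Elem :=
  if keySet l d ⊆ keySet l e ∧ ¬ keySet l f ⊆ keySet l e then keySet l d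
  else if ¬ keySet l d ⊆ keySet l e ∧ keySet l f ⊆ keySet l e then keySet l f
  else if keySet l d ⊆ keySet l f ∧ keySet l f ⊆ keySet l e then keySet l d
  else if keySet l f ⊆ keySet l d ∧ keySet l d ⊆ keySet l e then keySet l f
  else keySet l e

/-- A tripath of `q`: a database `Θ`, each of whose blocks has at most two facts,
whose blocks (indexed by `Fin m`) are arranged as a rooted tree with exactly one root
block and exactly two leaf blocks; the root block has the single fact `a(root)`, leaf
blocks have the single fact `b(leaf)`, all other blocks have exactly the two facts
`a(B) ≠ b(B)`; if `B` is the parent of `B'` then `Θ ⊨ q{a(B) b(B')}`; the (unique)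
branching block `B` with its two children `B', B''` gives the center `d e f` =
`b(B') a(B) b(B'')` with `(d,e)` and `(e,f)` distinct solutions; and `g(e)` is not
included in the key of the root fact nor of either leaf fact. -/
structure Tripath (l : ℕ) (q : Query n Var) (Θ : Set (Fin n → Elem)) where
  finite : Θ.Finite
  m : ℕ
  blk : Fin m → Set (Fin n → Elem)
  blk_is_block : ∀ i, ∃ x ∈ Θ, blk i = Block l Θ x
  blk_cover : Θ = ⋃ i, blk i
  blk_inj : Function.Injective blk
  blk_card : ∀ i, (blk i).ncard ≤ 2
  parent : Fin m → Option (Fin m)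
  root : Fin m
  parent_root : parent root = none
  parent_ne_root : ∀ i, i ≠ root → ∃ j, parent i = some j
  reach_root : ∀ i, Relation.ReflTransGen (fun x y => parent x = some y) i root
  leaf1 : Fin m
  leaf2 : Fin m
  leaf_ne : leaf1 ≠ leaf2
  leaf1_leaf : ∀ j, parent j ≠ some leaf1
  leaf2_leaf : ∀ j, parent j ≠ some leaf2
  leaves_eq : ∀ i, (∀ j, parent j ≠ some i) → i = leaf1 ∨ i = leaf2
  aFact : Fin m → (Fin n → Elem)
  bFact : Fin m → (Fin n → Elem)
  root_blk : blk root = {aFact root}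
  leaf1_blk : blk leaf1 = {bFact leaf1}
  leaf2_blk : blk leaf2 = {bFact leaf2}
  other_blk : ∀ i, i ≠ root → i ≠ leaf1 → i ≠ leaf2 →
    aFact i ≠ bFact i ∧ blk i = {aFact i, bFact i}
  adj_sol : ∀ i j, parent j = some i → SolSym q Θ (aFact i) (bFact j)
  branch : Fin m
  child1 : Fin m
  child2 : Fin m
  child_ne : child1 ≠ child2
  parent_child1 : parent child1 = some branch
  parent_child2 : parent child2 = some branch
  center_sol1 : Sol q Θ (bFact child1) (aFact branch)
  center_sol2 : Sol q Θ (aFact branch) (bFact child2)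
  center_distinct : (bFact child1, aFact branch) ≠ (aFact branch, bFact child2)
  g_root : ¬ gSet l (bFact child1) (aFact branch) (bFact child2) ⊆ keySet l (aFact root)
  g_leaf1 : ¬ gSet l (bFact child1) (aFact branch) (bFact child2) ⊆ keySet l (bFact leaf1)
  g_leaf2 : ¬ gSet l (bFact child1) (aFact branch) (bFact child2) ⊆ keySet l (bFact leaf2)

namespace Tripath

variable {l : ℕ} {q : Query n Var} {Θ : Set (Fin n → Elem)}

/-- The fact `d` of the center `def` of a tripath. -/
def dc (T : Tripath l q Θ) : Fin n → Elem := T.bFact T.child1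
/-- The fact `e` of the center `def` of a tripath. -/
def ec (T : Tripath l q Θ) : Fin n → Elem := T.aFact T.branch
/-- The fact `f` of the center `def` of a tripath. -/
def fc (T : Tripath l q Θ) : Fin n → Elem := T.bFact T.child2
/-- The root fact `u₀` of a tripath. -/
def u0 (T : Tripath l q Θ) : Fin n → Elem := T.aFact T.root
/-- The leaf fact `u₁` of a tripath. -/
def u1 (T : Tripath l q Θ) : Fin n → Elem := T.bFact T.leaf1
/-- The leaf fact `u₂` of a tripath. -/
def u2 (T : Tripath l q Θ) : Fin n → Elem := T.bFact T.leaf2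

/-- The center of the tripath is a fork (`(f,d)` is not a solution). -/
def IsFork (T : Tripath l q Θ) : Prop := ¬ Sol q Θ T.fc T.dc

/-- The center of the tripath is a triangle (`(f,d)` is a solution). -/
def IsTriangle (T : Tripath l q Θ) : Prop := Sol q Θ T.fc T.dc

/-- Variable-niceness witnessed by the elements `x, y, z`. -/
def VariableNiceWith (T : Tripath l q Θ) (x y z : Elem) : Prop :=
  x ∈ keySet l T.dc ∧ y ∈ keySet l T.ec ∧ z ∈ keySet l T.fc ∧
  ({x, y, z} : Set Elem) ∩ (keySet l T.u0 ∪ keySet l T.u1 ∪ keySet l T.u2) = ∅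

/-- The tripath is variable-nice. -/
def VariableNice (T : Tripath l q Θ) : Prop := ∃ x y z, T.VariableNiceWith x y z

/-- The tripath is solution-nice: the only solutions to `q` in `Θ` are those between a
parent block and a child block, plus possibly `(f, d)`. -/
def SolutionNice (T : Tripath l q Θ) : Prop :=
  ∀ a b, Sol q Θ a b →
    (∃ i j, T.parent j = some i ∧
      ((a = T.aFact i ∧ b = T.bFact j) ∨ (a = T.bFact j ∧ b = T.aFact i)))
    ∨ (a = T.fc ∧ b = T.dc)

/-- The tripath is nice. -/
def Nice (T : Tripath l q Θ) : Prop :=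
  (∃ x y z : Elem, T.VariableNiceWith x y z ∧
    ∃ w ∈ ({x, y, z} : Set Elem),
      ∀ c ∈ Θ, c ≠ T.u0 → c ≠ T.u1 → c ≠ T.u2 → w ∈ keySet l c) ∧
  T.SolutionNice ∧
  (∀ u ∈ ({T.u0, T.u1, T.u2} : Set (Fin n → Elem)),
    ∃ w ∈ keySet l u, ∀ c ∈ Θ, c ≠ u → w ∉ keySet l c)

end Tripath

/-- `D` contains a tripath of `q`: some subset of `D` is a tripath of `q`. -/
def ContainsTripath (l : ℕ) (q : Query n Var) (D : Set (Fin n → Elem)) : Prop :=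
  ∃ Θ ⊆ D, Nonempty (Tripath l q Θ)

/-- `q` admits a fork-tripath (over databases with elements in `Elem`). -/
def AdmitsForkTripath (l : ℕ) (q : Query n Var) (Elem : Type*) : Prop :=
  ∃ D : Set (Fin n → Elem), D.Finite ∧ ∃ Θ ⊆ D, ∃ T : Tripath l q Θ, T.IsFork

/-- `q` admits a triangle-tripath (over databases with elements in `Elem`). -/
def AdmitsTriangleTripath (l : ℕ) (q : Query n Var) (Elem : Type*) : Prop :=
  ∃ D : Set (Fin n → Elem), D.Finite ∧ ∃ Θ ⊆ D, ∃ T : Tripath l q Θ, T.IsTriangle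

/-- `q` admits a tripath (over databases with elements in `Elem`). -/
def AdmitsTripath (l : ℕ) (q : Query n Var) (Elem : Type*) : Prop :=
  ∃ D : Set (Fin n → Elem), D.Finite ∧ ContainsTripath l q D

/-- Edges of the solution graph `G(D,q)`: distinct facts `a, b` of `D` with `D ⊨ q{ab}`. -/
def gEdge (q : Query n Var) (D : Set (Fin n → Elem)) (a b : Fin n → Elem) : Prop :=
  a ≠ b ∧ a ∈ D ∧ b ∈ D ∧ SolSym q D a b

/-- The connected component of the fact `a` in the solution graph `G(D,q)`. -/
def gComp (q : Query n Var) (D : Set (Fin n → Elem)) (a : Fin n → Elem) :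
    Set (Fin n → Elem) :=
  {b ∈ D | Relation.ReflTransGen (gEdge q D) a b}

/-- `C` is a quasi-clique (of the solution graph of `D`): any two non-key-equal facts of
`C` are joined by an edge. -/
def QuasiClique (l : ℕ) (q : Query n Var) (D : Set (Fin n → Elem))
    (C : Set (Fin n → Elem)) : Prop :=
  ∀ a ∈ C, ∀ b ∈ C, ¬ keyEq l a b → SolSym q D a b

open Classical in
/-- `clique(a)`: the connected component of `a` in `G(D,q)` if it is a quasi-clique, and
`{a}` otherwise. -/
noncomputable def cliqueOf (l : ℕ) (q : Query n Var) (D : Set (Fin n → Elem))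
    (a : Fin n → Elem) : Set (Fin n → Elem) :=
  if QuasiClique l q D (gComp q D a) then gComp q D a else {a}

/-- Edges of the bipartite graph `H(D,q)`: between a block `B` of `D` and a set `c` of
the form `clique(y)`, when `B` contains a fact `a ∈ c` with `(a,a)` not a solution. -/
def HEdge (l : ℕ) (q : Query n Var) (D : Set (Fin n → Elem))
    (B c : Set (Fin n → Elem)) : Prop :=
  (∃ x ∈ D, B = Block l D x) ∧ (∃ y ∈ D, c = cliqueOf l q D y) ∧
  ∃ a ∈ B, a ∈ c ∧ ¬ Sol q D a a

/-- `H(D,q)` admits a matching saturating the set `V₁` of blocks of `D`: an injective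
assignment of an `H`-edge to every block. -/
def SaturatingMatching (l : ℕ) (q : Query n Var) (D : Set (Fin n → Elem)) : Prop :=
  ∃ M : Set (Fin n → Elem) → Set (Fin n → Elem),
    (∀ x ∈ D, HEdge l q D (Block l D x) (M (Block l D x))) ∧
    (∀ x ∈ D, ∀ y ∈ D, M (Block l D x) = M (Block l D y) → Block l D x = Block l D y)

/-- `D` is a clique-database for `q`: every connected component of `G(D,q)` is a
quasi-clique. -/
def CliqueDB (l : ℕ) (q : Query n Var) (D : Set (Fin n → Elem)) : Prop :=
  ∀ a ∈ D, QuasiClique l q D (gComp q D a)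

/-- `q` is a clique-query: every database (over `Elem`) is a clique-database for `q`. -/
def CliqueQuery (l : ℕ) (q : Query n Var) (Elem : Type*) : Prop :=
  ∀ D : Set (Fin n → Elem), D.Finite → CliqueDB l q D

/-- One step of `q`-connectedness between (the blocks of) two facts of `D`:
either they are in the same block, or some fact of the block of `x` and some fact
of the block of `y` form a solution. -/
def qConnRel (l : ℕ) (q : Query n Var) (D : Set (Fin n → Elem))
    (x y : Fin n → Elem) : Prop :=
  keyEq l x y ∨ ∃ a b, a ∈ Block l D x ∧ b ∈ Block l D y ∧ SolSym q D a b

/-- The blocks of `x` and of `y` are `q`-connected in `D`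
(reflexive-symmetric-transitive closure). -/
def qConn (l : ℕ) (q : Query n Var) (D : Set (Fin n → Elem))
    (x y : Fin n → Elem) : Prop :=
  Relation.EqvGen (qConnRel l q D) x y

/-- The `q`-connected component of (the block of) the fact `x` in `D`. -/
def qComponent (l : ℕ) (q : Query n Var) (D : Set (Fin n → Elem))
    (x : Fin n → Elem) : Set (Fin n → Elem) :=
  {y ∈ D | qConn l q D x y}

end CQA


namespace CQA

lemma comb_star (K : ℕ) : ∃ (C V : Type) (_ : Fintype C) (_ : Fintype V)
    (lab : C → ZMod 3 → V) (𝓕 : Set (C → ZMod 3)),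
    (∀ c t c' t', lab c t = lab c' t' → t = t') ∧
    Fintype.card C < Fintype.card V ∧ 𝓕.Nonempty ∧
    (∀ s ∈ 𝓕, ∀ C0 : Finset C, C0.card ≤ K → ∀ v, ∃ s' ∈ 𝓕,
      (∀ c ∈ C0, s' c = s c) ∧ ∃ c, lab c (s' c) = v) := by
  classical
  let C := Fin (K+2) × Fin (K+1)
  let V := Fin (K+3) ⊕ (Fin (K+2) × Fin K)
  let par : ℕ → ZMod 3 := fun j => if j % 2 = 0 then 0 else 1
  -- spine label
  let spine : Fin (K+2) → ℕ → V := fun h j =>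
    if hj : 0 < j ∧ j < K+1 then Sum.inr (h, ⟨j-1, by omega⟩)
    else if j = 0 then Sum.inl 0 else Sum.inl (Fin.last _)
  let lab : C → ZMod 3 → V := fun c t =>
    if t = 2 then Sum.inl ⟨c.2 + 1, by omega⟩
    else if t = par c.2 then spine c.1 c.2 else spine c.1 (c.2 + 1)
  let st : (Fin (K+2) → Fin (K+3)) → C → ZMod 3 := fun M c =>
    if (c.2:ℕ) + 1 < M c.1 then par (c.2+1) else if (c.2:ℕ) + 1 = M c.1 then 2 else par c.2
  have par01 : ∀ j, par j = 0 ∨ par j = 1 := by intro j; simp only [par]; split_ifs <;> simp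
  have par2 : ∀ j, par j ≠ 2 := by
    intro j; rcases par01 j with h | h <;> rw [h] <;> decide
  have parne : ∀ j, par (j+1) ≠ par j := by
    intro j; simp only [par]
    split_ifs <;> first | omega | decide
  have parother : ∀ t : ZMod 3, ∀ j, t ≠ 2 → t ≠ par j → t = par (j+1) := by
    intro t j h2 hp
    have h1 := parne j
    rcases par01 j with h | h <;> rcases par01 (j+1) with h' | h' <;> rw [h, h'] at h1 <;>
      rw [h] at hp <;> rw [h'] <;> revert t <;> simp at h1 ⊢ <;> decide
  have labR : ∀ c : C, lab c (par (c.2+1)) = spine c.1 (c.2+1) := by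
    intro c; simp only [lab]; rw [if_neg (par2 _), if_neg (parne _)]
  have labL : ∀ c : C, lab c (par c.2) = spine c.1 c.2 := by
    intro c; simp [lab, par2]
  have labT : ∀ c : C, lab c 2 = Sum.inl ⟨c.2 + 1, by omega⟩ := by
    intro c; simp [lab]
  have trich : ∀ (c : C) (t : ZMod 3), t = 2 ∨ (∃ j : ℕ, j ≤ K + 1 ∧ t = par j ∧ lab c t = spine c.1 j) := by
    intro c t
    by_cases h2 : t = 2
    · exact Or.inl h2
    by_cases hp : t = par c.2
    · right; exact ⟨c.2, by omega, hp, by rw [hp, labL]⟩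
    · right
      have := parother t c.2 h2 hp
      exact ⟨c.2+1, by omega, this, by rw [this, labR]⟩
  have spT : ∀ h j (i : Fin (K+1)), j ≤ K+1 → spine h j ≠ Sum.inl ⟨i+1, by omega⟩ := by
    intro h j i hj
    simp only [spine]
    split_ifs with h1 h2
    · simp
    · intro h; have := congrArg Fin.val (Sum.inl.inj h); simp at this
    · intro h; have := congrArg Fin.val (Sum.inl.inj h); simp at this; omega
  have spinj : ∀ h j h' j', j ≤ K+1 → j' ≤ K+1 → spine h j = spine h' j' → j = j' := by
    intro h j h' j' hj hj'
    simp only [spine]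
    split_ifs with h1 h2 h3 h4 h5 h6 h7 h8 <;> intro he
    · have := congrArg (fun p => (p.2 : ℕ)) (Sum.inr.inj he)
      simp only at this; omega
    all_goals first | omega | exact he.elim | (have := congrArg Fin.val (Sum.inl.inj he); simp at this)
  refine ⟨C, V, inferInstance, inferInstance, lab, st '' {M | Function.Injective M}, ?_, ?_, ?_, ?_⟩
  · intro c t c' t' h
    rcases trich c t with ht | ⟨j, hj, ht, hl⟩ <;> rcases trich c' t' with ht' | ⟨j', hj', ht', hl'⟩
    · rw [ht, ht']
    · rw [ht, labT, hl'] at h; exact absurd h.symm (spT _ _ _ hj')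
    · rw [ht', labT, hl] at h; exact absurd h (spT _ _ _ hj)
    · rw [hl, hl'] at h; rw [ht, ht', spinj _ _ _ _ hj hj' h]
  · simp only [C, V, Fintype.card_sum, Fintype.card_prod, Fintype.card_fin]
    ring_nf; omega
  · exact ⟨_, _, Fin.castSucc_injective _, rfl⟩
  · rintro _ ⟨M, hM, rfl⟩ C0 hC0 v
    have cover : ∀ (M : Fin (K+2) → Fin (K+3)) (h : Fin (K+2)), ∃ c, lab c (st M c) = Sum.inl (M h) := by
      intro M h
      rcases Nat.eq_zero_or_pos (M h : ℕ) with h0 | h0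
      · refine ⟨(h, 0), ?_⟩
        have : st M (h, 0) = par ((h, (0 : Fin (K+1))) : C).2 := by
          simp only [st]; rw [if_neg (by omega), if_neg (by omega)]
        rw [this, labL]
        simp [spine]; exact congrArg Sum.inl (Fin.ext h0.symm)
      by_cases h1 : (M h : ℕ) = K + 2
      · refine ⟨(h, Fin.last K), ?_⟩
        have : st M (h, Fin.last K) = par ((((h, Fin.last K) : C).2 : ℕ)+1) := by
          simp only [st]; rw [if_pos (by omega)]
        rw [this, labR]
        simp [spine]; exact congrArg Sum.inl (Fin.ext h1.symm)
      · have hlt := (M h).2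
        refine ⟨(h, ⟨M h - 1, by omega⟩), ?_⟩
        have : st M (h, ⟨M h - 1, by omega⟩) = 2 := by
          simp only [st]; rw [if_neg (by omega), if_pos (by omega)]
        rw [this, labT]
        congr 1; ext; simp; omega
    rcases v with p | ⟨h, j⟩
    · by_cases hp : ∃ h, M h = p
      · obtain ⟨h, rfl⟩ := hp
        exact ⟨_, ⟨M, hM, rfl⟩, fun _ _ => rfl, cover M h⟩
      · push Not at hp
        obtain ⟨h, hh⟩ : ∃ h, h ∉ C0.image Prod.fst := by
          by_contra hcon
          push Not at hcon
          have : (Finset.univ : Finset (Fin (K+2))).card ≤ (C0.image Prod.fst).card :=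
            Finset.card_le_card (fun x _ => hcon x)
          have h2 := Finset.card_image_le (s := C0) (f := Prod.fst)
          simp at this; omega
        refine ⟨_, ⟨Function.update M h p, ?_, rfl⟩, ?_, ?_⟩
        · intro a b hab
          by_cases ha : a = h <;> by_cases hb : b = h
          · rw [ha, hb]
          · subst ha; simp [Function.update_of_ne hb] at hab; exact absurd hab.symm (hp b)
          · subst hb; simp [Function.update_of_ne ha] at hab; exact absurd hab (hp a)
          · simp [Function.update_of_ne ha, Function.update_of_ne hb] at hab; exact hM hab
        · intro c hc
          have : c.1 ≠ h := by
            rintro rfl; exact hh (Finset.mem_image_of_mem _ hc)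
          simp only [st, Function.update_of_ne this]
        · obtain ⟨c, hc⟩ := cover (Function.update M h p) h
          exact ⟨c, by rw [hc]; simp⟩
    · refine ⟨_, ⟨M, hM, rfl⟩, fun _ _ => rfl, ?_⟩
      have hj := j.2
      by_cases hlt : (j:ℕ) + 1 < M h
      · refine ⟨(h, ⟨j, by omega⟩), ?_⟩
        have : st M (h, ⟨j, by omega⟩) = par ((((h, ⟨j, by omega⟩) : C).2 : ℕ)+1) := by
          simp only [st]; rw [if_pos (by simpa using hlt)]
        rw [this, labR]
        simp [spine]
      · refine ⟨(h, ⟨j+1, by omega⟩), ?_⟩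
        have : st M (h, ⟨j+1, by omega⟩) = par (((h, ⟨j+1, by omega⟩) : C).2 : ℕ) := by
          simp only [st]; rw [if_neg (by omega), if_neg (by omega)]
        rw [this, labL]
        simp [spine]

end CQA

namespace CQA

def Val (N : ℕ) (o : Bool) (j : ℕ) : Prop := if o = true then j ≤ N else j < N

lemma keyEq_symm' {l n : ℕ} {α : Type*} {s t : Fin n → α} (h : keyEq l s t) : keyEq l t s :=
  fun i hi => (h i hi).symm

lemma keyEq_trans' {l n : ℕ} {α : Type*} {s t u : Fin n → α} (h : keyEq l s t)
    (h' : keyEq l t u) : keyEq l s u :=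
  fun i hi => (h i hi).trans (h' i hi)

lemma repair_meets {l n : ℕ} {α : Type*} {D r : Set (Fin n → α)} (hr : Repair l D r)
    {x : Fin n → α} (hx : x ∈ D) : ∃ y ∈ r, keyEq l x y := by
  by_contra hcon
  push Not at hcon
  obtain ⟨h1, h2, h3⟩ := hr
  have hxr : x ∉ r := fun h => hcon x h (fun _ _ => rfl)
  have := h3 (insert x r) (Set.subset_insert _ _) (Set.insert_subset hx h1) (by
    intro a ha b hb hab
    rcases ha with rfl | ha <;> rcases hb with rfl | hb
    · rfl
    · exact absurd hab (hcon b hb)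
    · exact absurd (keyEq_symm' hab) (hcon a ha)
    · exact h2 a ha b hb hab)
  exact hxr (this ▸ Set.mem_insert x r)

theorem criterion {n l k N : ℕ} (hN : 0 < N) {Elem Var : Type} (q : Query n Var)
    {C V : Type} [Fintype C] [Fintype V] (lab : C → ZMod 3 → V)
    (hcard : Fintype.card C < Fintype.card V)
    (𝓕 : Set (C → ZMod 3)) (hne : 𝓕.Nonempty)
    (hstrat : ∀ s ∈ 𝓕, ∀ C0 : Finset C, C0.card ≤ k → ∀ v, ∃ s' ∈ 𝓕,
      (∀ c ∈ C0, s' c = s c) ∧ ∃ c, lab c (s' c) = v)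
    (F : Bool → C → ZMod 3 → ℕ → (Fin n → Elem))
    (h1 : ∀ c t j, j < N → keyEq l (F false c t j) (F true c t j))
    (h1' : ∀ c t c' t', lab c t = lab c' t' → keyEq l (F true c t N) (F true c' t' N))
    (h2 : ∀ o c t j o' c' t' j', Val N o j → Val N o' j' →
      keyEq l (F o c t j) (F o' c' t' j') →
      (c = c' ∧ t = t' ∧ j = j') ∨ (j = N ∧ j' = N ∧ lab c t = lab c' t'))
    (h3 : ∀ c t j, j < N → solPair q (F false c t j) (F true c t (j+1)) ∨
      solPair q (F true c t (j+1)) (F false c t j))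
    (h3' : ∀ c t, solPair q (F true c t 0) (F true c (t+1) 0))
    (h4 : ∀ o c t j o' c' t' j', Val N o j → Val N o' j' →
      (c = c' → t = t' → o = o') → (c = c' → t ≠ t' → ¬ (o = true ∧ o' = true)) →
      ¬ solPair q (F o c t j) (F o' c' t' j')) :
    ∃ D : Set (Fin n → Elem), D.Finite ∧ Certain l q D ∧ ∅ ∉ Delta l k q D := by
  classical
  let D : Set (Fin n → Elem) := {x | ∃ o c t j, Val N o j ∧ x = F o c t j}
  have hmem : ∀ o c t j, Val N o j → F o c t j ∈ D := fun o c t j h => ⟨o, c, t, j, h, rfl⟩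
  refine ⟨D, ?_, ?_, ?_⟩
  · have : D ⊆ Set.range (fun p : Bool × C × ZMod 3 × Fin (N+1) => F p.1 p.2.1 p.2.2.1 p.2.2.2) := by
      rintro x ⟨o, c, t, j, hv, rfl⟩
      refine ⟨(o, c, t, ⟨j, ?_⟩), rfl⟩
      unfold Val at hv
      split_ifs at hv <;> omega
    exact (Set.finite_range _).subset this
  · intro r hr
    by_contra hsat
    have nosol : ∀ a ∈ r, ∀ b ∈ r, ¬ solPair q a b := fun a ha b hb h => hsat ⟨a, b, ha, hb, h⟩
    have hsurj : ∀ v, ∃ c t, lab c t = v := by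
      intro v
      obtain ⟨s, hs⟩ := hne
      obtain ⟨s', _, _, c, hc⟩ := hstrat s hs ∅ (by simp) v
      exact ⟨c, _, hc⟩
    have hpick : ∀ v, ∃ p : C × ZMod 3, lab p.1 p.2 = v ∧ F true p.1 p.2 N ∈ r := by
      intro v
      obtain ⟨c, t, hct⟩ := hsurj v
      have hv : Val N true N := by simp [Val]
      obtain ⟨y, hy, hk⟩ := repair_meets hr (hmem true c t N hv)
      obtain ⟨o, c', t', j', hv', rfl⟩ := hr.1 hy
      have key : j' = N ∧ lab c' t' = v := by
        rcases h2 _ _ _ _ _ _ _ _ hv hv' hk with ⟨rfl, rfl, rfl⟩ | ⟨_, rfl, h⟩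
        · exact ⟨rfl, hct⟩
        · exact ⟨rfl, h ▸ hct⟩
      obtain ⟨rfl, hl⟩ := key
      cases o with
      | false => simp [Val] at hv'
      | true => exact ⟨(c', t'), hl, hy⟩
    have hdown : ∀ c t, F true c t N ∈ r → F true c t 0 ∈ r := by
      intro c t h
      have : ∀ i, i ≤ N → F true c t (N - i) ∈ r := by
        intro i
        induction i with
        | zero => intro _; exact h
        | succ i ih =>
          intro hi
          have ih := ih (by omega)
          obtain ⟨j, hj⟩ : ∃ j, N - i = j + 1 := ⟨N - i - 1, by omega⟩
          have hj' : N - (i+1) = j := by omega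
          rw [hj'] ; rw [hj] at ih
          have hjN : j < N := by omega
          have hv : Val N true j := by simp [Val]; omega
          obtain ⟨y, hy, hk⟩ := repair_meets hr (hmem true c t j hv)
          obtain ⟨o, c', t', j', hv', rfl⟩ := hr.1 hy
          rcases h2 _ _ _ _ _ _ _ _ hv hv' hk with ⟨rfl, rfl, rfl⟩ | ⟨h, _, _⟩
          · cases o with
            | true => exact hy
            | false =>
              rcases h3 c t j hjN with h | h
              · exact absurd h (nosol _ hy _ ih)
              · exact absurd h (nosol _ ih _ hy)
          · omega
      simpa using this N le_rfl
    choose g hg1 hg2 using hpick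
    have tri : ∀ t t' : ZMod 3, t = t' ∨ t' = t + 1 ∨ t = t' + 1 := by decide
    have hinj : Function.Injective (fun v => (g v).1) := by
      intro v v' hvv
      simp only at hvv
      have a1 := hdown _ _ (hg2 v)
      have a2 := hdown _ _ (hg2 v')
      have e1 := hg1 v
      have e2 := hg1 v'
      rw [← hvv] at a2 e2
      generalize (g v).2 = t at *
      generalize (g v').2 = t' at *
      have : t = t' ∨ t' = t + 1 ∨ t = t' + 1 := tri t t'
      rcases this with h | h | h
      · rw [← e1, ← e2, h]
      · subst h; exact absurd (h3' _ _) (nosol _ a1 _ a2)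
      · subst h; exact absurd (h3' _ _) (nosol _ a2 _ a1)
    have := Fintype.card_le_of_injective _ hinj
    omega
  · let Ch : (C → ZMod 3) → Set (Fin n → Elem) := fun s =>
      {x | ∃ o c t j, Val N o j ∧ (o = true ↔ s c = t) ∧ x = F o c t j}
    have hcl : DeltaClosed l k q D {S | ¬ ∃ s ∈ 𝓕, S ⊆ Ch s} := by
      constructor
      · rintro S hS ⟨a, b, ha, hb, hab⟩ ⟨s, hs, hsub⟩
        obtain ⟨o, c, t, j, hv, ho, rfl⟩ := hsub ha
        obtain ⟨o', c', t', j', hv', ho', rfl⟩ := hsub hb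
        refine h4 _ _ _ _ _ _ _ _ hv hv' ?_ ?_ hab
        · rintro rfl rfl
          rw [Bool.eq_iff_iff, ho, ho']
        · rintro rfl hne ⟨h, h'⟩
          exact hne ((ho.1 h).symm.trans (ho'.1 h'))
      · rintro S hS ⟨x, hx, hblk⟩ ⟨s, hs, hsub⟩
        suffices hh : ∃ s' ∈ 𝓕, S ⊆ Ch s' ∧ ∃ u ∈ D, u ∈ Ch s' ∧ keyEq l x u by
          obtain ⟨s', hs', hsub', u, hu, huc, hk⟩ := hh
          obtain ⟨S', hS', _, hn⟩ := hblk u hu hk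
          exact hn ⟨s', hs', hS'.trans (Set.union_subset hsub' (by simpa using huc))⟩
        obtain ⟨o, c, t, j, hv, rfl⟩ := hx
        by_cases hj : j < N
        · refine ⟨s, hs, hsub, F (decide (s c = t)) c t j, hmem _ _ _ _ ?_,
            ⟨_, c, t, j, ?_, ?_, rfl⟩, ?_⟩
          · unfold Val; split_ifs <;> omega
          · unfold Val; split_ifs <;> omega
          · simp
          · cases o <;> cases (decide (s c = t))
            · exact fun _ _ => rfl
            · exact h1 c t j hj
            · exact keyEq_symm' (h1 c t j hj)
            · exact fun _ _ => rfl
        · have hjN : o = true ∧ j = N := by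
            cases o <;> simp [Val] at hv
            · omega
            · exact ⟨rfl, by omega⟩
          obtain ⟨rfl, rfl⟩ := hjN
          have hsub2 : ∀ a, a ∈ S → ∃ o c t j', Val j o j' ∧ (o = true ↔ s c = t) ∧ a = F o c t j' :=
            fun a ha => hsub ha
          have : Nonempty C := ⟨c⟩
          choose! fo fc ft fj hf1 hf2 hf3 using hsub2
          obtain ⟨hSD, hfin, hSk, _⟩ := hS
          have hC0 : (hfin.toFinset.image fc).card ≤ k := by
            refine Finset.card_image_le.trans ?_
            rwa [← Set.ncard_eq_toFinset_card S hfin]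
          obtain ⟨s', hs', hagree, c', hc'⟩ := hstrat s hs _ hC0 (lab c t)
          refine ⟨s', hs', ?_, F true c' (s' c') j, hmem _ _ _ _ (by simp [Val]),
            ⟨true, c', _, j, by simp [Val], by simp, rfl⟩, h1' _ _ _ _ hc'.symm⟩
          intro a ha
          refine ⟨fo a, fc a, ft a, fj a, hf1 a ha, ?_, hf3 a ha⟩
          rw [hagree (fc a) (Finset.mem_image_of_mem _ (by simpa using ha))]
          exact hf2 a ha
    intro h
    obtain ⟨s, hs⟩ := hne
    have := h _ hcl
    exact this ⟨s, hs, Set.empty_subset _⟩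

end CQA

namespace CQA

def StepB (l : ℕ) {n : ℕ} {Var : Type} (q : Query n Var) (κ κ' : Fin n → Bool) : Prop :=
  ∃ ν : Var → Bool, keyEq l κ (fun i => ν (q.1 i)) ∧ keyEq l κ' (fun i => ν (q.2 i))

def LAdj (l : ℕ) {n : ℕ} {Var : Type} (q : Query n Var)
    (p p' : ZMod 3 × (Fin n → Bool)) : Prop :=
  (p'.1 = p.1 + 1 ∧ StepB l q p.2 p'.2) ∨ (p.1 = p'.1 + 1 ∧ StepB l q p'.2 p.2)

def AdjN (l : ℕ) {n : ℕ} {Var : Type} (q : Query n Var) (YV : Var → Prop)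
    (κ κ' : Fin n → Bool) : Prop :=
  ∃ ν : Var → Bool, (∀ v, ν v = true → YV v) ∧
    ((keyEq l κ (fun i => ν (q.1 i)) ∧ keyEq l κ' (fun i => ν (q.2 i))) ∨
     (keyEq l κ (fun i => ν (q.2 i)) ∧ keyEq l κ' (fun i => ν (q.1 i))))

lemma z3 : ∀ t : ZMod 3, t = 0 ∨ t = 1 ∨ t = 2 := by decide

section
variable {l n : ℕ} {Var E0 : Type} {q : Query n Var} {T : ZMod 3 → Fin n → E0}
  {β : ZMod 3 → Var → E0}

lemma ladj_overlay (hA : ∀ t i, β t (q.1 i) = T t i) (hB : ∀ t i, β t (q.2 i) = T (t+1) i)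
    (θ : E0 → Bool → Bool) {p p' : ZMod 3 × (Fin n → Bool)}
    (h : Relation.ReflTransGen (LAdj l q) p p') :
    Relation.ReflTransGen (LAdj l q) (p.1, fun i => θ (T p.1 i) (p.2 i))
      (p'.1, fun i => θ (T p'.1 i) (p'.2 i)) := by
  have key : ∀ t κ κ', StepB l q κ κ' →
      StepB l q (fun i => θ (T t i) (κ i)) (fun i => θ (T (t+1) i) (κ' i)) := by
    rintro t κ κ' ⟨ν, h1, h2⟩
    refine ⟨fun v => θ (β t v) (ν v), ?_, ?_⟩
    · intro i hi; simp only [hA]; rw [h1 i hi]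
    · intro i hi; simp only [hB]; rw [h2 i hi]
  induction h with
  | refl => exact .refl
  | tail _ hs ih =>
    refine ih.tail ?_
    rcases hs with ⟨h1, h2⟩ | ⟨h1, h2⟩
    · left; refine ⟨h1, ?_⟩; simp only [h1]; exact key _ _ _ h2
    · right; refine ⟨h1, ?_⟩; simp only [h1]; exact key _ _ _ h2

lemma ladj_shift (r : ZMod 3) {p p' : ZMod 3 × (Fin n → Bool)}
    (h : Relation.ReflTransGen (LAdj l q) p p') :
    Relation.ReflTransGen (LAdj l q) (p.1 + r, p.2) (p'.1 + r, p'.2) := by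
  induction h with
  | refl => exact .refl
  | tail _ hs ih =>
    refine ih.tail ?_
    rcases hs with ⟨h1, h2⟩ | ⟨h1, h2⟩
    · left; refine ⟨?_, h2⟩; simp only [h1]; ring
    · right; refine ⟨?_, h2⟩; simp only [h1]; ring

open Classical in
lemma ladj_triv (hA : ∀ t i, β t (q.1 i) = T t i) (hB : ∀ t i, β t (q.2 i) = T (t+1) i)
    (Z : Set E0) (t t' : ZMod 3) :
    Relation.ReflTransGen (LAdj l q) (t, fun i => decide (T t i ∈ Z))
      (t', fun i => decide (T t' i ∈ Z)) := by
  have step : ∀ t : ZMod 3, LAdj l q (t, fun i => decide (T t i ∈ Z))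
      (t+1, fun i => decide (T (t+1) i ∈ Z)) := by
    intro t
    left; refine ⟨rfl, fun v => decide (β t v ∈ Z), ?_, ?_⟩
    · intro i hi; simp only [hA]
    · intro i hi; simp only [hB]
  have : t' = t ∨ t' = t + 1 ∨ t' = t + 1 + 1 := by revert t t'; clear * -; decide
  rcases this with rfl | rfl | rfl
  · exact .refl
  · exact .single (step _)
  · exact (Relation.ReflTransGen.single (step _)).tail (step _)

open Classical in
lemma ladj_add (hA : ∀ t i, β t (q.1 i) = T t i) (hB : ∀ t i, β t (q.2 i) = T (t+1) i)
    {x : E0} {t0 s : ZMod 3} {κ : Fin n → Bool}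
    (h : Relation.ReflTransGen (LAdj l q) (t0, fun _ => false) (s, κ))
    (hx : ∀ i : Fin n, (i:ℕ) < l → T s i = x → κ i = true) (Z W : Set E0)
    (hW : ∀ z, z ∈ W ↔ z = x ∨ z ∈ Z) (t t' : ZMod 3) :
    Relation.ReflTransGen (LAdj l q) (t, fun i => decide (T t i ∈ Z))
      (t', fun i => decide (T t' i ∈ W)) := by
  have h2 := ladj_overlay hA hB (fun z b => decide (z ∈ Z) || (b && decide (z = x))) h
  simp only [Bool.false_and, Bool.or_false] at h2
  have h3 := (ladj_triv (l := l) hA hB Z t t0).trans h2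
  have h4 : StepB l q (fun i => decide (T s i ∈ Z) || (κ i && decide (T s i = x)))
      (fun i => decide (T (s+1) i ∈ W)) := by
    refine ⟨fun v => decide (β s v ∈ W), ?_, ?_⟩
    · intro i hi
      simp only [hA, hW]
      by_cases h : T s i = x
      · simp [h, hx i hi h]
      · simp [h]
    · intro i hi; simp only [hB]
  have h5 := ladj_triv (l := l) hA hB W (s+1) t'
  refine (h3.tail (c := (s+1, fun i => decide (T (s+1) i ∈ W))) ?_).trans h5
  exact Or.inl ⟨rfl, h4⟩

open Classical in
lemma b0_walk (hA : ∀ t i, β t (q.1 i) = T t i) (hB : ∀ t i, β t (q.2 i) = T (t+1) i)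
    (ω : E0 → E0) (hω : Function.Injective ω) (hωT : ∀ t i, T (t+1) i = ω (T t i))
    (hω3 : ∀ x, ω (ω (ω x)) = x)
    (x0 : E0) (t0 s : ZMod 3) (κ : Fin n → Bool)
    (h : Relation.ReflTransGen (LAdj l q) (t0, fun _ => false) (s, κ))
    (hx : ∀ i : Fin n, (i:ℕ) < l → T s i = x0 → κ i = true)
    (X : Set E0) (hX : X = {x0, ω x0, ω (ω x0)}) :
    (∀ t i, T t i ∈ X ↔ T 0 i ∈ X) ∧
    Relation.ReflTransGen (AdjN l q (fun v => β 0 v ∈ X)) (fun _ => false)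
      (fun i => decide (T 0 i ∈ X)) := by
  have hXω : ∀ z, ω z ∈ X ↔ z ∈ X := by
    intro z
    rw [hX]
    constructor
    · rintro (h | h | h)
      · right; right
        apply hω; rw [h, hω3]
      · left; exact hω h
      · right; left; exact hω h
    · rintro (h | h | h)
      · right; left; rw [h]
      · right; right; rw [h]; rfl
      · left; rw [h]; exact hω3 _
  have hXT : ∀ t i, T t i ∈ X ↔ T 0 i ∈ X := by
    intro t i
    rcases z3 t with rfl | rfl | rfl
    · rfl
    · rw [← hXω (T 0 i), ← hωT, zero_add]
    · rw [← hXω (T 2 i), ← hωT]; rfl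
  refine ⟨hXT, ?_⟩
  have rot : ∀ r : ZMod 3, ∀ x, (∀ i, T (s+r) i = x → T s i = x0) → ∀ Z W : Set E0, (∀ z, z ∈ W ↔ z = x ∨ z ∈ Z) →
    Relation.ReflTransGen (LAdj l q) (0, fun i => decide (T 0 i ∈ Z))
      (0, fun i => decide (T 0 i ∈ W)) := by
    intro r x hr Z W hW
    exact ladj_add hA hB (ladj_shift r h) (fun i hi h => hx i hi (hr i h)) Z W hW 0 0
  have r0 := rot 0 x0 (by simp) ∅ {x0} (by simp)
  have r1 := rot 1 (ω x0) (by intro i h; rw [hωT] at h; exact hω h) {x0} {x0, ω x0}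
    (by intro z; simp only [Set.mem_insert_iff, Set.mem_singleton_iff]; tauto)
  have r2 := rot 2 (ω (ω x0)) (by
    intro i h
    have : s + 2 = s + 1 + 1 := by ring
    rw [this, hωT, hωT] at h; exact hω (hω h)) {x0, ω x0} X
    (by intro z; rw [hX]; simp only [Set.mem_insert_iff, Set.mem_singleton_iff]; tauto)
  have hall : Relation.ReflTransGen (LAdj l q) (0, fun _ => false)
      (0, fun i => decide (T 0 i ∈ X)) := by
    have := (r0.trans r1).trans r2
    simpa using this
  have mask : ∀ p p' : ZMod 3 × (Fin n → Bool), Relation.ReflTransGen (LAdj l q) p p' →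
      Relation.ReflTransGen (AdjN l q (fun v => β 0 v ∈ X))
        (fun i => p.2 i && decide (T 0 i ∈ X)) (fun i => p'.2 i && decide (T 0 i ∈ X)) := by
    intro p p' h
    have key : ∀ κ κ', StepB l q κ κ' → ∃ ν : Var → Bool, (∀ v, ν v = true → β 0 v ∈ X) ∧
        keyEq l (fun i => κ i && decide (T 0 i ∈ X)) (fun i => ν (q.1 i)) ∧
        keyEq l (fun i => κ' i && decide (T 0 i ∈ X)) (fun i => ν (q.2 i)) := by
      rintro κ κ' ⟨ν, h1, h2⟩
      refine ⟨fun v => ν v && decide (β 0 v ∈ X), by simp, ?_, ?_⟩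
      · intro i hi; simp only [hA]; rw [h1 i hi]
      · intro i hi; simp only [hB, hXT (0+1)]; rw [h2 i hi]
    induction h with
    | refl => exact .refl
    | tail _ hs ih =>
      refine ih.tail ?_
      rcases hs with ⟨h1, h2⟩ | ⟨h1, h2⟩
      · obtain ⟨ν, a, b, c⟩ := key _ _ h2
        exact ⟨ν, a, Or.inl ⟨b, c⟩⟩
      · obtain ⟨ν, a, b, c⟩ := key _ _ h2
        exact ⟨ν, a, Or.inr ⟨c, b⟩⟩
  have := mask _ _ hall
  simpa using this

end

lemma trip_mem {n l : ℕ} {Elem Var : Type} {q : Query n Var} {Θ : Set (Fin n → Elem)}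
    (P : Tripath l q Θ) : (∀ i, (∃ j, P.parent j = some i) → P.aFact i ∈ P.blk i) ∧
    (∀ i, i ≠ P.root → P.bFact i ∈ P.blk i) := by
  constructor
  · rintro i ⟨j, hj⟩
    by_cases h : i = P.root
    · subst h; rw [P.root_blk]; rfl
    · have h1 : i ≠ P.leaf1 := by rintro rfl; exact P.leaf1_leaf j hj
      have h2 : i ≠ P.leaf2 := by rintro rfl; exact P.leaf2_leaf j hj
      rw [(P.other_blk i h h1 h2).2]; simp
  · intro i h
    by_cases h1 : i = P.leaf1
    · rw [h1, P.leaf1_blk]; rfl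
    by_cases h2 : i = P.leaf2
    · rw [h2, P.leaf2_blk]; rfl
    rw [(P.other_blk i h h1 h2).2]; simp

lemma trip_blk {n l : ℕ} {Elem Var : Type} {q : Query n Var} {Θ : Set (Fin n → Elem)}
    (P : Tripath l q Θ) {i j a b} (ha : a ∈ P.blk i) (hb : b ∈ P.blk j) :
    keyEq l a b ↔ i = j := by
  obtain ⟨x, hx, ex⟩ := P.blk_is_block i
  obtain ⟨y, hy, ey⟩ := P.blk_is_block j
  constructor
  · intro h
    apply P.blk_inj
    rw [ex] at ha ⊢
    rw [ey] at hb ⊢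
    have hxy : keyEq l x y := keyEq_trans' ha.2 (keyEq_trans' h (keyEq_symm' hb.2))
    ext z
    constructor
    · rintro ⟨h1, h2⟩; exact ⟨h1, keyEq_trans' (keyEq_symm' hxy) h2⟩
    · rintro ⟨h1, h2⟩; exact ⟨h1, keyEq_trans' hxy h2⟩
  · rintro rfl
    rw [ex] at ha hb
    exact keyEq_trans' (keyEq_symm' ha.2) hb.2

open Classical in
theorem layerB0 {n l : ℕ} {Elem Var : Type} (q : Query n Var)
    (ht : AdmitsTriangleTripath l q Elem) :
    ∃ (T : ZMod 3 → Fin n → Elem × Elem × Elem) (β : ZMod 3 → Var → Elem × Elem × Elem)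
      (X : Set (Elem × Elem × Elem)),
      (∀ t i, β t (q.1 i) = T t i) ∧ (∀ t i, β t (q.2 i) = T (t+1) i) ∧
      (∀ t t', keyEq l (T t) (T t') → t = t') ∧
      (∀ t i, T t i ∈ X ↔ T 0 i ∈ X) ∧ (∃ i : Fin n, (i:ℕ) < l ∧ T 0 i ∈ X) ∧
      Relation.ReflTransGen (AdjN l q (fun v => β 0 v ∈ X)) (fun _ => false)
        (fun i => decide (T 0 i ∈ X)) := by
  obtain ⟨D, _, Θ, _, P, hP⟩ := ht
  obtain ⟨_, _, μ1, a1, b1⟩ := P.center_sol1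
  obtain ⟨_, _, μ2, a2, b2⟩ := P.center_sol2
  obtain ⟨_, _, μ3, a3, b3⟩ := hP
  have hgr := P.g_root
  have hde : ¬ keyEq l (P.bFact P.child1) (P.aFact P.branch) := by
    have hb := (trip_mem P).1 _ ⟨_, P.parent_child1⟩
    have hc : P.child1 ≠ P.root := by
      intro h; have := P.parent_child1; rw [h, P.parent_root] at this; simp at this
    rw [trip_blk P ((trip_mem P).2 _ hc) hb]
    intro h
    have hp := P.parent_child1
    rw [← h] at hp
    have : ∀ y, Relation.ReflTransGen (fun x y => P.parent x = some y) P.child1 y →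
        y = P.child1 := by
      intro y hy
      induction hy with
      | refl => rfl
      | tail _ hs ih => subst ih; rw [hp] at hs; exact (Option.some.inj hs).symm
    exact hc (this _ (P.reach_root _)).symm
  have hup : ∀ b, Relation.ReflTransGen (fun x y => P.parent x = some y) P.branch b →
      ∃ j, P.parent j = some b := by
    intro b h
    induction h with
    | refl => exact ⟨_, P.parent_child1⟩
    | tail _ hs ih => exact ⟨_, hs⟩
  change ∀ i, μ3 (q.1 i) = P.bFact P.child2 i at a3
  change ∀ i, μ3 (q.2 i) = P.bFact P.child1 i at b3
  set d := P.bFact P.child1 with hd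
  set e := P.aFact P.branch with he
  set f := P.bFact P.child2 with hf
  let T : ZMod 3 → Fin n → Elem × Elem × Elem := fun t i =>
    if t = 0 then (d i, e i, f i) else if t = 1 then (e i, f i, d i) else (f i, d i, e i)
  let β : ZMod 3 → Var → Elem × Elem × Elem := fun t v =>
    if t = 0 then (μ1 v, μ2 v, μ3 v) else if t = 1 then (μ2 v, μ3 v, μ1 v)
    else (μ3 v, μ1 v, μ2 v)
  have c1 : ¬ (1 : ZMod 3) = 0 := by decide
  have c2 : ¬ (2 : ZMod 3) = 0 := by decide
  have c3 : ¬ (2 : ZMod 3) = 1 := by decide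
  have c4 : (1 + 1 : ZMod 3) = 2 := by decide
  have c5 : (2 + 1 : ZMod 3) = 0 := by decide
  have T0 : ∀ i, T 0 i = (d i, e i, f i) := fun i => if_pos rfl
  have T1 : ∀ i, T 1 i = (e i, f i, d i) := fun i => by simp only [T, if_neg c1, if_true]
  have T2 : ∀ i, T 2 i = (f i, d i, e i) := fun i => by simp only [T, if_neg c2, if_neg c3]
  have B0 : ∀ v, β 0 v = (μ1 v, μ2 v, μ3 v) := fun i => if_pos rfl
  have B1 : ∀ v, β 1 v = (μ2 v, μ3 v, μ1 v) := fun i => by simp only [β, if_neg c1, if_true]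
  have B2 : ∀ v, β 2 v = (μ3 v, μ1 v, μ2 v) := fun i => by simp only [β, if_neg c2, if_neg c3]
  clear_value T β
  have hA : ∀ t i, β t (q.1 i) = T t i := by
    intro t i
    rcases z3 t with rfl | rfl | rfl
    · rw [B0, T0, a1, a2, a3]
    · rw [B1, T1, a1, a2, a3]
    · rw [B2, T2, a1, a2, a3]
  have hB : ∀ t i, β t (q.2 i) = T (t+1) i := by
    intro t i
    rcases z3 t with rfl | rfl | rfl
    · rw [B0, zero_add, T1, b1, b2, b3]
    · rw [B1, c4, T2, b1, b2, b3]
    · rw [B2, c5, T0, b1, b2, b3]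
  have hinj : ∀ t t', keyEq l (T t) (T t') → t = t' := by
    intro t t' h
    by_contra hne
    apply hde
    rcases z3 t with rfl | rfl | rfl <;> rcases z3 t' with rfl | rfl | rfl <;>
      first
      | exact absurd rfl hne
      | (intro i hi; have := h i hi; simp only [T0, T1, T2, Prod.mk.injEq] at this; first | exact this.1 | exact this.2.1 | exact this.2.2 | exact this.1.symm | exact this.2.1.symm | exact this.2.2.symm)
  let ω : Elem × Elem × Elem → Elem × Elem × Elem := fun x => (x.2.1, x.2.2, x.1)
  have hω : Function.Injective ω := by
    rintro ⟨x, y, z⟩ ⟨x', y', z'⟩ h; simp [ω] at h ⊢; tauto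
  have hωT : ∀ t i, T (t+1) i = ω (T t i) := by
    intro t i
    rcases z3 t with rfl | rfl | rfl
    · rw [zero_add, T0, T1]
    · rw [c4, T1, T2]
    · rw [c5, T2, T0]
  have hω3 : ∀ x, ω (ω (ω x)) = x := fun x => rfl
  have claim : ∃ (x0 : Elem × Elem × Elem) (t0 s : ZMod 3) (κ : Fin n → Bool),
      (∃ t, ∃ i : Fin n, (i:ℕ) < l ∧ T t i = x0) ∧
      Relation.ReflTransGen (LAdj l q) (t0, fun _ => false) (s, κ) ∧
      (∀ i : Fin n, (i:ℕ) < l → T s i = x0 → κ i = true) := by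
    by_cases hsub : keySet l (T 0) ⊆ keySet l (T 1)
    · have s1 : keySet l d ⊆ keySet l e := by
        rintro _ ⟨i, hi, rfl⟩
        obtain ⟨j, hj, h⟩ := hsub ⟨i, hi, rfl⟩
        rw [T1, T0] at h; exact ⟨j, hj, (Prod.ext_iff.1 h).1⟩
      have s2 : keySet l e ⊆ keySet l f := by
        rintro _ ⟨i, hi, rfl⟩
        obtain ⟨j, hj, h⟩ := hsub ⟨i, hi, rfl⟩
        rw [T1, T0] at h; exact ⟨j, hj, (Prod.ext_iff.1 (Prod.ext_iff.1 h).2).1⟩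
      have s3 : keySet l f ⊆ keySet l d := by
        rintro _ ⟨i, hi, rfl⟩
        obtain ⟨j, hj, h⟩ := hsub ⟨i, hi, rfl⟩
        rw [T1, T0] at h; exact ⟨j, hj, (Prod.ext_iff.1 (Prod.ext_iff.1 h).2).2⟩
      have hg : gSet l d e f = keySet l e := by
        have e1 : keySet l d = keySet l e := s1.antisymm (s2.trans s3)
        have e2 : keySet l f = keySet l e := (s3.trans s1).antisymm s2
        unfold gSet
        simp [e1, e2]
      rw [hg, Set.not_subset] at hgr
      obtain ⟨_, ⟨i0, hi0, rfl⟩, hy⟩ := hgr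
      have hwalk : ∀ b, Relation.ReflTransGen (fun x y => P.parent x = some y) P.branch b →
          ∃ s : ZMod 3, Relation.ReflTransGen (LAdj l q) (1, fun _ => false)
            (s, fun i => decide (P.aFact b i ≠ (T s i).1)) := by
        intro b hb
        induction hb with
        | refl =>
          refine ⟨1, ?_⟩
          have : (fun i => decide (P.aFact P.branch i ≠ (T 1 i).1)) = fun _ => false := by
            funext i; rw [T1]; simp [he]
          rw [this]
        | @tail b p hb hs ih =>
          obtain ⟨s, ih⟩ := ih
          have hbr : b ≠ P.root := by
            rintro rfl; rw [P.parent_root] at hs; simp at hs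
          have hk : keyEq l (P.aFact b) (P.bFact b) :=
            (trip_blk P ((trip_mem P).1 b (hup b hb)) ((trip_mem P).2 b hbr)).2 rfl
          rcases P.adj_sol _ _ hs with ⟨_, _, μ, ha, hb'⟩ | ⟨_, _, μ, ha, hb'⟩
          · obtain ⟨r, rfl⟩ : ∃ r, s = r + 1 := ⟨s - 1, by ring⟩
            refine ⟨r, ih.tail (Or.inr ⟨rfl, fun v => decide (μ v ≠ (β r v).1), ?_, ?_⟩)⟩
            · intro i hi; simp only [hA, ha]
            · intro i hi; simp only [hB, hb', hk i hi]
          · refine ⟨s + 1, ih.tail (Or.inl ⟨rfl, fun v => decide (μ v ≠ (β s v).1), ?_, ?_⟩)⟩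
            · intro i hi; simp only [hA, ha, hk i hi]
            · intro i hi; simp only [hB, hb']
      obtain ⟨s, hs⟩ := hwalk _ (P.reach_root _)
      refine ⟨T 1 i0, 1, s, _, ⟨1, i0, hi0, rfl⟩, hs, ?_⟩
      intro i hi h
      rw [h, T1]
      simp only [decide_eq_true_eq]
      intro h'
      exact hy ⟨i, hi, h'⟩
    · rw [Set.not_subset] at hsub
      obtain ⟨_, ⟨i, hi, rfl⟩, hn⟩ := hsub
      exact ⟨T 0 i, 1, 1, _, ⟨0, i, hi, rfl⟩, .refl, fun j hj h => absurd ⟨j, hj, h⟩ hn⟩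
  obtain ⟨x0, t0, s, κ, ⟨t, i, hi, hti⟩, hr, hx⟩ := claim
  obtain ⟨r1, r2⟩ := b0_walk hA hB ω hω hωT hω3 x0 t0 s κ hr hx {x0, ω x0, ω (ω x0)} rfl
  refine ⟨T, β, _, hA, hB, hinj, r1, ⟨i, hi, ?_⟩, r2⟩
  rw [← r1 t, hti]; simp

end CQA

namespace CQA

def sr {n : ℕ} {Var : Type} (q : Query n Var) (w : Bool) : Fin n → Var :=
  if w = true then q.1 else q.2

lemma AdjN_iff {l n : ℕ} {Var : Type} {q : Query n Var} {YV : Var → Prop}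
    {κ κ' : Fin n → Bool} : AdjN l q YV κ κ' ↔ ∃ (ν : Var → Bool) (w : Bool),
      (∀ v, ν v = true → YV v) ∧ keyEq l κ (fun i => ν (sr q w i)) ∧
      keyEq l κ' (fun i => ν (sr q (!w) i)) := by
  constructor
  · rintro ⟨ν, h, h1 | h1⟩
    · exact ⟨ν, true, h, h1⟩
    · exact ⟨ν, false, h, h1⟩
  · rintro ⟨ν, w, h, h1⟩
    cases w
    · exact ⟨ν, h, Or.inr h1⟩
    · exact ⟨ν, h, Or.inl h1⟩

lemma AdjN_symm {l n : ℕ} {Var : Type} {q : Query n Var} {YV : Var → Prop}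
    {κ κ' : Fin n → Bool} (h : AdjN l q YV κ κ') : AdjN l q YV κ' κ := by
  obtain ⟨ν, h, h1 | h1⟩ := h
  · exact ⟨ν, h, Or.inr ⟨h1.2, h1.1⟩⟩
  · exact ⟨ν, h, Or.inl ⟨h1.2, h1.1⟩⟩

def RD (l : ℕ) {n : ℕ} {Var : Type} (q : Query n Var) (Y : Fin n → Prop) (YV : Var → Prop) :
    ℕ → (Fin n → Bool) → Prop
  | 0, κ => ∀ i : Fin n, (i:ℕ) < l → Y i → κ i = true
  | k+1, κ => ∃ κ', AdjN l q YV κ κ' ∧ RD l q Y YV k κ'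

lemma spath {l n : ℕ} {Var : Type} {q : Query n Var} {Y : Fin n → Prop} {YV : Var → Prop}
    (hY : ∀ w i, YV (sr q w i) → Y i) (hex : ∃ i : Fin n, (i:ℕ) < l ∧ Y i)
    {κ0 : Fin n → Bool} (hwalk : Relation.ReflTransGen (AdjN l q YV) (fun _ => false) κ0)
    (hκ0 : ∀ i : Fin n, (i:ℕ) < l → Y i → κ0 i = true) :
    ∃ (m : ℕ) (L : ℕ → Fin n → Bool) (ν : ℕ → Var → Bool) (w : ℕ → Bool), 0 < m ∧
      (∀ i, L 0 i = false) ∧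
      (∀ i, i < m → keyEq l (L i) (fun p => ν i (sr q (w i) p))) ∧
      (∀ i, i < m → keyEq l (L (i+1)) (fun p => ν i (sr q (!(w i)) p))) ∧
      (∀ p : Fin n, (p:ℕ) < l → Y p → L m p = true) ∧
      (∀ i, i < m → ∃ p : Fin n, (p:ℕ) < l ∧ Y p ∧ L i p = false) ∧
      (∀ i, 0 < i → i ≤ m → ∃ p : Fin n, (p:ℕ) < l ∧ Y p ∧ L i p = true) ∧
      (∀ i k, i ≤ m → k ≤ m → keyEq l (L i) (L k) → i = k) ∧
      (∀ i k, i < k → k ≤ m → AdjN l q YV (L i) (L k) → k = i + 1) ∧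
      (∀ i, i ≤ m → ∀ p : Fin n, (p:ℕ) < l → L i p = true → Y p) := by
  classical
  have hR0 : ∃ k, RD l q Y YV k (fun _ => false) := by
    revert hwalk
    generalize (fun _ : Fin n => false) = κ
    intro hwalk
    induction hwalk using Relation.ReflTransGen.head_induction_on with
    | refl => exact ⟨0, hκ0⟩
    | head h _ ih => obtain ⟨k, hk⟩ := ih; exact ⟨k+1, _, h, hk⟩
  have hinv : ∀ k κ κ', keyEq l κ κ' → RD l q Y YV k κ → RD l q Y YV k κ' := by
    intro k κ κ' h hr
    cases k with
    | zero => intro i hi hy; rw [← h i hi]; exact hr i hi hy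
    | succ k =>
      obtain ⟨κ'', h1, h2⟩ := hr
      refine ⟨κ'', ?_, h2⟩
      rw [AdjN_iff] at h1 ⊢
      obtain ⟨ν, w, a, b, c⟩ := h1
      exact ⟨ν, w, a, keyEq_trans' (keyEq_symm' h) b, c⟩
  let m := Nat.find hR0
  have hm : RD l q Y YV m (fun _ => false) := Nat.find_spec hR0
  have hmin : ∀ k, RD l q Y YV k (fun _ => false) → m ≤ k := fun k h => Nat.find_min' hR0 h
  have hstep : ∀ k κ, ∃ κ', RD l q Y YV (k+1) κ → AdjN l q YV κ κ' ∧ RD l q Y YV k κ' := by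
    intro k κ
    by_cases h : RD l q Y YV (k+1) κ
    · obtain ⟨κ', h'⟩ := h; exact ⟨κ', fun _ => h'⟩
    · exact ⟨κ, fun h' => absurd h' h⟩
  choose nx hnx using hstep
  let L : ℕ → Fin n → Bool := fun i => Nat.rec (fun _ => false) (fun i κ => nx (m - i - 1) κ) i
  have L0 : L 0 = fun _ => false := rfl
  have LS : ∀ i, L (i+1) = nx (m - i - 1) (L i) := fun i => rfl
  clear_value L
  have hL : ∀ i, i ≤ m → RD l q Y YV (m - i) (L i) := by
    intro i
    induction i with
    | zero => intro _; rw [L0]; exact hm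
    | succ i ih =>
      intro hi
      have h1 := ih (by omega)
      have e : m - i = (m - i - 1) + 1 := by omega
      rw [e] at h1
      rw [LS]; exact (hnx _ _ h1).2
  have hadj : ∀ i, i < m → AdjN l q YV (L i) (L (i+1)) := by
    intro i hi
    have h1 := hL i (by omega)
    have e : m - i = (m - i - 1) + 1 := by omega
    rw [e] at h1
    rw [LS]; exact (hnx _ _ h1).1
  have hdist : ∀ i, i ≤ m → ∀ k, RD l q Y YV k (L i) → m ≤ k + i := by
    intro i
    induction i with
    | zero => intro _ k h; rw [L0] at h; exact hmin k h
    | succ i ih =>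
      intro hi k h
      have := ih (by omega) (k+1) ⟨_, hadj i (by omega), h⟩
      omega
  have hinj : ∀ i k, i ≤ m → k ≤ m → keyEq l (L i) (L k) → i = k := by
    intro i k hi hk h
    have h1 := hdist i hi _ (hinv _ _ _ (keyEq_symm' h) (hL k hk))
    have h2 := hdist k hk _ (hinv _ _ _ h (hL i hi))
    omega
  have hadj2 : ∀ i, ∃ (ν : Var → Bool) (w : Bool), i < m →
      (∀ v, ν v = true → YV v) ∧ keyEq l (L i) (fun p => ν (sr q w p)) ∧
      keyEq l (L (i+1)) (fun p => ν (sr q (!w) p)) := by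
    intro i
    by_cases h : i < m
    · obtain ⟨ν, w, h'⟩ := AdjN_iff.1 (hadj i h); exact ⟨ν, w, fun _ => h'⟩
    · exact ⟨fun _ => true, true, fun h' => absurd h' h⟩
  choose ν w hνw using hadj2
  refine ⟨m, L, ν, w, ?_, ?_, fun i hi => (hνw i hi).2.1, fun i hi => (hνw i hi).2.2, ?_, ?_, ?_,
    hinj, ?_, ?_⟩
  · by_contra h
    have h0 : m = 0 := by omega
    obtain ⟨i, hi, hy⟩ := hex
    rw [h0] at hm
    have := hm i hi hy
    simp at this
  · intro i; rw [L0]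
  · have := hL m le_rfl
    rw [Nat.sub_self] at this
    exact this
  · intro i hi
    by_contra hcon
    push Not at hcon
    have : RD l q Y YV 0 (L i) := by
      intro p hp hy
      have := hcon p hp hy
      simpa using this
    have := hdist i hi.le 0 this
    omega
  · intro i h0 hi
    by_contra hcon
    push Not at hcon
    have : keyEq l (L i) (L 0) := by
      intro p hp
      rw [L0]
      cases hb : L i p with
      | false => rfl
      | true =>
        exfalso
        obtain ⟨j, rfl⟩ : ∃ j, i = j + 1 := ⟨i - 1, by omega⟩
        obtain ⟨a1, a2, a3⟩ := hνw j (by omega)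
        have h3 := a3 p hp
        rw [hb] at h3
        exact hcon p hp (hY _ _ (a1 _ h3.symm)) hb
    have := hinj _ _ hi (by omega) this
    omega
  · intro i k hik hk h
    have := hdist i (by omega) (m - k + 1) ⟨_, h, hL k hk⟩
    omega
  · intro i hi p hp hb
    rcases Nat.eq_zero_or_pos i with rfl | h0
    · rw [L0] at hb; simp at hb
    · obtain ⟨j, rfl⟩ : ∃ j, i = j + 1 := ⟨i - 1, by omega⟩
      obtain ⟨a1, a2, a3⟩ := hνw j (by omega)
      have h3 := a3 p hp
      rw [hb] at h3
      exact hY _ _ (a1 _ h3.symm)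

structure Arm (l : ℕ) {n : ℕ} {Var : Type} (q : Query n Var) (Y : Fin n → Prop)
    (YV : Var → Prop) where
  N : ℕ
  hN : 0 < N
  dir : ℕ → Bool
  mu : ℕ → Var → Bool ⊕ (ℕ × Var)
  pb : ℕ → Fin n → Bool ⊕ (ℕ × Var)
  pb0 : ∀ i, pb 0 i = Sum.inl false
  pbS : ∀ j i, pb (j+1) i = mu j (sr q (!(dir j)) i)
  lev : ℕ → ZMod 3
  lev0 : lev 0 = 0
  levS : ∀ j, lev (j+1) = lev j + (if dir j = true then 1 else -1)
  glue : ∀ j, j < N → keyEq l (pb j) (fun i => mu j (sr q (dir j) i))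
  priv : ℕ → Prop
  priv0 : ¬ priv 0
  privN : ¬ priv N
  alt : ∀ j, j < N → priv j ∨ priv (j+1)
  turn : ∀ j, j + 1 < N → priv (j+1) → dir (j+1) = !(dir j)
  privEl : ∀ j, j < N → priv j → ∃ (p : Fin n) (r : ℕ × Var), (p:ℕ) < l ∧ pb j p = Sum.inr r ∧
    ∀ e, e < N → ∀ v, mu e v = Sum.inr r → e = j ∨ e + 1 = j
  Lk : ℕ → Fin n → Bool
  Lpb : ∀ j, j ≤ N → ¬ priv j → ∀ p : Fin n, (p:ℕ) < l → pb j p = Sum.inl (Lk j p)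
  LY : ∀ j, j ≤ N → ¬ priv j → ∀ p : Fin n, (p:ℕ) < l → Lk j p = true → Y p
  Lfalse : ∀ j, j < N → ¬ priv j → ∃ p : Fin n, (p:ℕ) < l ∧ Y p ∧ Lk j p = false
  Ltrue : ∀ j, 0 < j → j ≤ N → ¬ priv j → ∃ p : Fin n, (p:ℕ) < l ∧ Y p ∧ Lk j p = true
  Lend : ∀ p : Fin n, (p:ℕ) < l → Y p → Lk N p = true
  Linj : ∀ j j', j ≤ N → j' ≤ N → ¬ priv j → ¬ priv j' → keyEq l (Lk j) (Lk j') → j = j'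
  Ladj : ∀ j j', j < j' → j' ≤ N → ¬ priv j → ¬ priv j' → AdjN l q YV (Lk j) (Lk j') →
    lev j = lev j' ∨ (dir (j'-1) = dir j ∧ lev j' = lev j + (if dir j = true then 1 else -1))
  first : ∃ p, sr q (!(dir 0)) p ∈ varsSet (sr q (dir 0)) ∧ ∃ r, mu 0 (sr q (dir 0) p) = Sum.inr r


lemma nonbad {l n : ℕ} {Var : Type} {q : Query n Var} (hq : TwoWayDet l q) :
    ∃ (s : Bool) (p : Fin n), sr q (!s) p ∈ varsSet (sr q s) ∧ sr q s p ∉ keySet l (sr q s) := by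
  obtain ⟨h1, h2, h3, h4⟩ := hq
  by_contra hcon
  push Not at hcon
  rw [Set.not_subset] at h1
  obtain ⟨x, hx, hxn⟩ := h1
  obtain ⟨p, hp⟩ := h3 hx
  have hxv : x ∈ varsSet q.1 := by
    obtain ⟨i, _, hi⟩ := hx; exact ⟨i, hi⟩
  have a1 : q.1 p ∈ keySet l q.1 := hcon true p (by simpa [sr, hp] using hxv)
  have a2 : q.2 p ∈ keySet l q.2 := hcon false p (by simpa [sr] using h3 a1)
  exact hxn (hp ▸ a2)

lemma sr_key {l n : ℕ} {Var : Type} {q : Query n Var} (hq : TwoWayDet l q) (w : Bool) :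
    (∃ i : Fin n, (i:ℕ) < l ∧ sr q w i ∉ keySet l (sr q (!w))) := by
  obtain ⟨h1, h2, h3, h4⟩ := hq
  cases w
  · rw [Set.not_subset] at h2
    obtain ⟨_, ⟨i, hi, rfl⟩, h⟩ := h2
    exact ⟨i, hi, h⟩
  · rw [Set.not_subset] at h1
    obtain ⟨_, ⟨i, hi, rfl⟩, h⟩ := h1
    exact ⟨i, hi, h⟩

open Classical in
theorem arm_exists {l n : ℕ} {Var : Type} {q : Query n Var} (hq : TwoWayDet l q)
    {Y : Fin n → Prop} {YV : Var → Prop}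
    (hY : ∀ w i, YV (sr q w i) → Y i) (hex : ∃ i : Fin n, (i:ℕ) < l ∧ Y i)
    {κ0 : Fin n → Bool} (hwalk : Relation.ReflTransGen (AdjN l q YV) (fun _ => false) κ0)
    (hκ0 : ∀ i : Fin n, (i:ℕ) < l → Y i → κ0 i = true) : Nonempty (Arm l q Y YV) := by
  obtain ⟨m, L, ν, w, hm, L0, hL1, hL2, hend, hfalse, htrue, hinj, hadj, hLY⟩ :=
    spath hY hex hwalk hκ0
  obtain ⟨s, ps, hps1, hps2⟩ := nonbad hq
  obtain ⟨j0, hj0, hj0s⟩ : ∃ j0 : ℕ, j0 ≤ 1 ∧ ((j0 = 0 ∧ w 0 = s) ∨ (j0 = 1 ∧ w 0 = !s)) := by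
    by_cases h : w 0 = s
    · exact ⟨0, by omega, Or.inl ⟨rfl, h⟩⟩
    · exact ⟨1, le_rfl, Or.inr ⟨rfl, by revert h; cases w 0 <;> cases s <;> simp⟩⟩
  let kS : ℕ → Var → Prop := fun i v => v ∈ keySet l (sr q (w i))
  let kD : ℕ → Var → Prop := fun i v => v ∈ keySet l (sr q (!(w i)))
  let FR : ℕ → Var → Bool ⊕ (ℕ × Var) := fun i v =>
    if i = 0 ∧ j0 = 1 then Sum.inl false else Sum.inr (3*i, v)
  let MU : ℕ → Var → Bool ⊕ (ℕ × Var) := fun E v =>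
    if E % 3 = 0 then (if kS (E/3) v then Sum.inl (ν (E/3) v) else FR (E/3) v)
    else if E % 3 = 1 then
      (if kD (E/3) v then (if kS (E/3) v then Sum.inl (ν (E/3) v) else FR (E/3) v)
        else Sum.inr (E, v))
    else (if kD (E/3) v then Sum.inl (ν (E/3) v) else
      if kS (E/3) v then Sum.inr (E-1, v) else Sum.inr (E, v))
  let DR : ℕ → Bool := fun E => if E % 3 = 1 then !(w (E/3)) else w (E/3)
  have d0 : ∀ i, (3*i)/3 = i := by intro i; omega
  have d1 : ∀ i, (3*i+1)/3 = i := by intro i; omega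
  have d2 : ∀ i, (3*i+2)/3 = i := by intro i; omega
  have m0 : ∀ i, (3*i)%3 = 0 := by intro i; omega
  have m1 : ∀ i, (3*i+1)%3 = 1 := by intro i; omega
  have m2 : ∀ i, (3*i+2)%3 = 2 := by intro i; omega
  have MU0 : ∀ i v, MU (3*i) v = if kS i v then Sum.inl (ν i v) else FR i v := by
    intro i v; simp only [MU, d0, m0, if_true]
  have MU1 : ∀ i v, MU (3*i+1) v = if kD i v then
      (if kS i v then Sum.inl (ν i v) else FR i v) else Sum.inr (3*i+1, v) := by
    intro i v; simp only [MU, d1, m1, if_true, one_ne_zero, if_false]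
  have MU2 : ∀ i v, MU (3*i+2) v = if kD i v then Sum.inl (ν i v) else
      if kS i v then Sum.inr (3*i+1, v) else Sum.inr (3*i+2, v) := by
    intro i v
    have a : ¬ ((2:ℕ) = 0) := by omega
    have b : ¬ ((2:ℕ) = 1) := by omega
    have c : 3*i+2-1 = 3*i+1 := by omega
    simp only [MU, d2, m2, if_neg a, if_neg b, c]
  have D0 : ∀ i, DR (3*i) = w i := by intro i; simp [DR]
  have D1 : ∀ i, DR (3*i+1) = !(w i) := by intro i; simp [DR, d1, m1]
  have D2 : ∀ i, DR (3*i+2) = w i := by intro i; simp [DR, d2, m2]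
  have FRi : ∀ i v x, FR i v = Sum.inr x → x = (3*i, v) := by
    intro i v x h
    simp only [FR] at h
    split_ifs at h
    exact (Sum.inr.inj h).symm
  have FRn : ∀ i v, ¬ (i = 0 ∧ j0 = 1) → FR i v = Sum.inr (3*i, v) := by
    intro i v h; simp only [FR, if_neg h]
  have hmk : ∀ w' (i : Fin n), (i:ℕ) < l → sr q w' i ∈ keySet l (sr q w') :=
    fun w' i hi => ⟨i, hi, rfl⟩
  have split3 : ∀ E : ℕ, ∃ i, E = 3*i ∨ E = 3*i+1 ∨ E = 3*i+2 := by
    intro E; exact ⟨E/3, by omega⟩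
  have FRf : ∀ v, j0 = 1 → FR 0 v = Sum.inl false := by
    intro v h; simp only [FR, h]; rfl
  have hν0 : ∀ p : Fin n, (p:ℕ) < l → ν 0 (sr q (w 0) p) = false := by
    intro p hp
    have := hL1 0 hm p hp
    rw [L0] at this; exact this.symm
  clear_value MU DR FR
  let pb : ℕ → Fin n → Bool ⊕ (ℕ × Var) := fun j p =>
    if j = 0 then Sum.inl false else MU (j-1+j0) (sr q (!(DR (j-1+j0))) p)
  have pb0 : ∀ p, pb 0 p = Sum.inl false := fun p => if_pos rfl
  have pbS : ∀ j p, pb (j+1) p = MU (j+j0) (sr q (!(DR (j+j0))) p) := by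
    intro j p; simp [pb]
  have pbE : ∀ j E, j ≠ 0 → j + j0 = E + 1 → ∀ p, pb j p = MU E (sr q (!(DR E)) p) := by
    intro j E h1 h2 p
    simp only [pb, if_neg h1]
    have : j - 1 + j0 = E := by omega
    rw [this]
  clear_value pb
  have fresh : ∀ E v x, MU E v = Sum.inr x →
      (x.1 = E ∨ (E % 3 = 1 ∧ x.1 + 1 = E) ∨ (E % 3 = 2 ∧ x.1 + 1 = E)) := by
    intro E v x h
    obtain ⟨i, rfl | rfl | rfl⟩ := split3 E
    · rw [MU0] at h
      split_ifs at h
      have := FRi _ _ _ h; left; rw [this]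
    · rw [MU1] at h
      split_ifs at h
      · have := FRi _ _ _ h; right; left; rw [this]; exact ⟨m1 i, rfl⟩
      · left; rw [← Sum.inr.inj h]
    · rw [MU2] at h
      split_ifs at h
      · right; right; rw [← Sum.inr.inj h]; exact ⟨m2 i, rfl⟩
      · left; rw [← Sum.inr.inj h]
  let lev : ℕ → ZMod 3 := fun j =>
    Nat.rec 0 (fun j x => x + (if DR (j+j0) = true then 1 else -1)) j
  have lev0 : lev 0 = 0 := rfl
  have levS : ∀ j, lev (j+1) = lev j + (if DR (j+j0) = true then 1 else -1) := fun j => rfl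
  clear_value lev
  have Lpb : ∀ j, j ≤ 3*m-j0 → ¬ ((j+j0) % 3 ≠ 0 ∧ j ≠ 0) → ∀ p : Fin n, (p:ℕ) < l →
      pb j p = Sum.inl (L ((j+j0)/3) p) := by
    intro j hj hnp p hp
    by_cases h0 : j = 0
    · subst h0
      have : (0 + j0)/3 = 0 := by omega
      rw [pb0, this, L0]
    · obtain ⟨i, hi⟩ : ∃ i, j + j0 = 3*i+2+1 := ⟨(j+j0)/3-1, by omega⟩
      rw [pbE j _ h0 hi, hi, D2, MU2, if_pos (hmk _ p hp)]
      have : (3*i+2+1)/3 = i+1 := by omega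
      rw [this, hL2 i (by omega) p hp]
  refine ⟨{
    N := 3*m - j0
    hN := by omega
    dir := fun e => DR (e+j0)
    mu := fun e => MU (e+j0)
    pb := pb
    pb0 := pb0
    pbS := pbS
    lev := lev
    lev0 := lev0
    levS := levS
    glue := ?_
    priv := fun j => (j+j0) % 3 ≠ 0 ∧ j ≠ 0
    priv0 := by simp
    privN := by omega
    alt := by omega
    turn := ?_
    privEl := ?_
    Lk := fun j => L ((j+j0)/3)
    Lpb := Lpb
    LY := fun j hj _ p hp hb => hLY _ (by omega) p hp hb
    Lfalse := ?_
    Ltrue := ?_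
    Lend := ?_
    Linj := ?_
    Ladj := ?_
    first := ?_ }⟩
  · intro j hj p hp
    simp only
    by_cases h0 : j = 0
    · subst h0
      rw [pb0, zero_add]
      rcases hj0s with ⟨rfl, _⟩ | ⟨rfl, _⟩
      · have e := D0 0
        have e' := MU0 0
        rw [mul_zero] at e e'
        rw [e, e', if_pos (hmk _ p hp), hν0 p hp]
      · have e := D1 0
        have e' := MU1 0
        rw [mul_zero, zero_add] at e e'
        rw [e, e', if_pos (hmk _ p hp)]
        split_ifs with h
        · obtain ⟨p', hp', h⟩ := h
          rw [← h, hν0 p' hp']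
        · rw [FRf _ rfl]
    · obtain ⟨i, hi⟩ := split3 (j+j0)
      rcases hi with hi | hi | hi
      · rw [Lpb j hj.le (by omega) p hp, hi, d0, D0, MU0, if_pos (hmk _ p hp), hL1 i (by omega) p hp]
      · rw [pbE j _ h0 hi, hi, D0, D1, MU0, MU1, if_pos (hmk _ p hp)]
      · have hi' : j + j0 = 3*i+1+1 := by omega
        rw [pbE j _ h0 hi', hi, D2, D1, MU1, MU2, Bool.not_not]
        have : kS i (sr q (w i) p) := hmk _ p hp
        simp only [if_pos this]
  · intro j hj hp
    obtain ⟨i, hi⟩ := split3 (j+1+j0)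
    rcases hi with hi | hi | hi
    · omega
    · have hi' : j + j0 = 3*i := by omega
      rw [hi, hi', D1, D0]
    · have hi' : j + j0 = 3*i+1 := by omega
      rw [hi, hi', D2, D1, Bool.not_not]
  · intro j hj hp
    obtain ⟨i, hi⟩ := split3 (j+j0)
    rcases hi with hi | hi | hi
    · omega
    · obtain ⟨p, hp', hpn⟩ := sr_key hq (!(w i))
      rw [Bool.not_not] at hpn
      refine ⟨p, (3*i, sr q (!(w i)) p), hp', ?_, ?_⟩
      · rw [pbE j _ hp.2 hi, D0, MU0, if_neg hpn, FRn _ _ (by omega)]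
      · intro e he v h
        have := fresh _ _ _ h
        simp only at this
        omega
    · obtain ⟨p, hp', hpn⟩ := sr_key hq (w i)
      have hi' : j + j0 = 3*i+1+1 := by omega
      refine ⟨p, (3*i+1, sr q (w i) p), hp', ?_, ?_⟩
      · rw [pbE j _ hp.2 hi', D1, Bool.not_not, MU1, if_neg hpn]
      · intro e he v h
        have := fresh _ _ _ h
        simp only at this
        omega
  · intro j hj hp
    exact hfalse _ (by omega)
  · intro j h0 hj hp
    exact htrue _ (by omega) (by omega)
  · intro p hp hy
    have : (3*m - j0 + j0)/3 = m := by omega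
    simp only [this]
    exact hend p hp hy
  · intro j j' hj hj' hp hp' h
    have := hinj _ _ (by omega) (by omega) h
    omega
  · intro j j' hjj hj' hp hp' h
    have hk := hadj _ _ (by omega) (by omega) h
    by_cases h3 : (j + j0) % 3 = 0
    · obtain ⟨i, hi⟩ : ∃ i, j + j0 = 3*i := ⟨(j+j0)/3, by omega⟩
      have e : j' = j + 1 + 1 + 1 := by omega
      subst e
      right
      have e1 : j + 1 + 1 + 1 - 1 + j0 = 3*i+2 := by omega
      have e2 : j + 1 + j0 = 3*i+1 := by omega
      have e3 : j + 1 + 1 + j0 = 3*i+2 := by omega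
      rw [levS, levS, levS, hi, e1, e2, e3, D0, D1, D2]
      refine ⟨rfl, ?_⟩
      cases w i <;> simp
    · left
      have e : j = 0 ∧ j0 = 1 ∧ j' = 0 + 1 + 1 := by omega
      obtain ⟨rfl, rfl, rfl⟩ := e
      have e := D1 0
      have e' := D2 0
      rw [mul_zero] at e e'
      rw [levS, levS]
      simp only [zero_add] at *
      norm_num at *
      rw [e, e']
      cases w 0 <;> simp
  · have hd : DR (0 + j0) = s := by
      rcases hj0s with ⟨rfl, h⟩ | ⟨rfl, h⟩
      · have := D0 0; rw [mul_zero] at this; rw [add_zero, this, h]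
      · have := D1 0; rw [mul_zero] at this; rw [this, h, Bool.not_not]
    refine ⟨ps, ?_, ?_⟩
    · simp only [hd]; exact hps1
    · simp only [hd]
      rcases hj0s with ⟨rfl, h⟩ | ⟨rfl, h⟩
      · have e' := MU0 0; rw [mul_zero] at e'
        have : ¬ kS 0 (sr q s ps) := by simp only [kS, h]; exact hps2
        rw [add_zero, e', if_neg this, FRn _ _ (by omega)]; exact ⟨_, rfl⟩
      · have e' := MU1 0; rw [mul_zero] at e'
        have : ¬ kD 0 (sr q s ps) := by simp only [kD, h, Bool.not_not]; exact hps2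
        rw [e', if_neg this]; exact ⟨_, rfl⟩

end CQA

namespace CQA

section Det
variable {l n : ℕ} {Var E : Type} {q : Query n Var}

lemma det_vars1 (hq : TwoWayDet l q) {a b : Fin n → E} (h : solPair q a b) (p : Fin n)
    (hp : (p:ℕ) < l) : ∃ p', a p = b p' := by
  obtain ⟨μ, h1, h2⟩ := h
  obtain ⟨p', hp'⟩ := hq.2.2.1 ⟨p, hp, rfl⟩
  exact ⟨p', by rw [← h1, ← h2, hp']⟩

lemma det_vars2 (hq : TwoWayDet l q) {a b : Fin n → E} (h : solPair q a b) (p : Fin n)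
    (hp : (p:ℕ) < l) : ∃ p', b p = a p' := by
  obtain ⟨μ, h1, h2⟩ := h
  obtain ⟨p', hp'⟩ := hq.2.2.2 ⟨p, hp, rfl⟩
  exact ⟨p', by rw [← h1, ← h2, hp']⟩

lemma detA (hq : TwoWayDet l q) {a b b' : Fin n → E} (h : solPair q a b)
    (h' : solPair q a b') : keyEq l b b' := by
  obtain ⟨μ, h1, h2⟩ := h
  obtain ⟨μ', h1', h2'⟩ := h'
  intro p hp
  obtain ⟨p', hp'⟩ := hq.2.2.2 ⟨p, hp, rfl⟩
  rw [← h2, ← h2', ← hp', h1, h1']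

lemma detB (hq : TwoWayDet l q) {a a' b : Fin n → E} (h : solPair q a b)
    (h' : solPair q a' b) : keyEq l a a' := by
  obtain ⟨μ, h1, h2⟩ := h
  obtain ⟨μ', h1', h2'⟩ := h'
  intro p hp
  obtain ⟨p', hp'⟩ := hq.2.2.1 ⟨p, hp, rfl⟩
  rw [← h1, ← h1', ← hp', h2, h2']

end Det

section El
variable {E Var C V : Type}

abbrev Tg (Var C V : Type) := Option (C ⊕ (V ⊕ (C × ZMod 3 × (ℕ × Var))))

open Classical in
noncomputable def elx (X : Set E) (lab : C → ZMod 3 → V) (c : C) (t : ZMod 3) (x : E) :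
    Bool ⊕ (ℕ × Var) → E × Tg Var C V
  | Sum.inl b => (x, if x ∈ X then
      (if b = true then some (Sum.inr (Sum.inl (lab c t))) else some (Sum.inl c)) else none)
  | Sum.inr r => (x, some (Sum.inr (Sum.inr (c, t, r))))

variable {X : Set E} {lab : C → ZMod 3 → V} {c c' : C} {t t' : ZMod 3} {x x' : E}

lemma elx_fst (p : Bool ⊕ (ℕ × Var)) : (elx X lab c t x p).1 = x := by
  cases p <;> rfl

lemma elx_inr {r : ℕ × Var} {p : Bool ⊕ (ℕ × Var)}
    (h : elx X lab c t x (Sum.inr r) = elx X lab c' t' x' p) : c = c' ∧ t = t' ∧ p = Sum.inr r := by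
  cases p with
  | inl b =>
    simp only [elx, Prod.mk.injEq] at h
    obtain ⟨_, h⟩ := h
    split_ifs at h <;> simp at h
  | inr r' =>
    simp only [elx, Prod.mk.injEq, Option.some.injEq, Sum.inr.injEq] at h
    exact ⟨h.2.1, h.2.2.1, by rw [h.2.2.2]⟩

lemma elx_false (hx : x ∈ X) {p : Bool ⊕ (ℕ × Var)}
    (h : elx X lab c t x (Sum.inl false) = elx X lab c' t' x' p) :
    c = c' ∧ p = Sum.inl false := by
  cases p with
  | inl b =>
    simp only [elx, Prod.mk.injEq] at h
    obtain ⟨rfl, h⟩ := h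
    cases b <;> simp [hx] at h ⊢
    exact h
  | inr r' => simp [elx, hx] at h

lemma elx_true (hx : x ∈ X) {p : Bool ⊕ (ℕ × Var)}
    (h : elx X lab c t x (Sum.inl true) = elx X lab c' t' x' p) :
    lab c t = lab c' t' ∧ p = Sum.inl true := by
  cases p with
  | inl b =>
    simp only [elx, Prod.mk.injEq] at h
    obtain ⟨rfl, h⟩ := h
    cases b <;> simp [hx] at h ⊢
    exact h
  | inr r' => simp [elx, hx] at h

lemma elx_none (hx : x ∉ X) (b b' : Bool) :
    elx (Var := Var) X lab c t x (Sum.inl b) = elx X lab c' t' x (Sum.inl b') := by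
  simp [elx, hx]

end El

section Main
variable {l n : ℕ} {E Var C V : Type} {q : Query n Var}

theorem layerB2 (hq : TwoWayDet l q) {T : ZMod 3 → Fin n → E} {β : ZMod 3 → Var → E} {X : Set E}
    (hA : ∀ t i, β t (q.1 i) = T t i) (hB : ∀ t i, β t (q.2 i) = T (t+1) i)
    (hT : ∀ t t', keyEq l (T t) (T t') → t = t') (hX : ∀ t i, T t i ∈ X ↔ T 0 i ∈ X)
    (ar : Arm l q (fun i => T 0 i ∈ X) (fun v => β 0 v ∈ X))
    (lab : C → ZMod 3 → V) (hlab : ∀ c t c' t', lab c t = lab c' t' → t = t') :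
    ∃ F : Bool → C → ZMod 3 → ℕ → (Fin n → E × Tg Var C V),
    (∀ c t j, j < ar.N → keyEq l (F false c t j) (F true c t j)) ∧
    (∀ c t c' t', lab c t = lab c' t' → keyEq l (F true c t ar.N) (F true c' t' ar.N)) ∧
    (∀ o c t j o' c' t' j', Val ar.N o j → Val ar.N o' j' →
      keyEq l (F o c t j) (F o' c' t' j') →
      (c = c' ∧ t = t' ∧ j = j') ∨ (j = ar.N ∧ j' = ar.N ∧ lab c t = lab c' t')) ∧
    (∀ c t j, j < ar.N → solPair q (F false c t j) (F true c t (j+1)) ∨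
      solPair q (F true c t (j+1)) (F false c t j)) ∧
    (∀ c t, solPair q (F true c t 0) (F true c (t+1) 0)) ∧
    (∀ o c t j o' c' t' j', Val ar.N o j → Val ar.N o' j' →
      (c = c' → t = t' → o = o') → (c = c' → t ≠ t' → ¬ (o = true ∧ o' = true)) →
      ¬ solPair q (F o c t j) (F o' c' t' j')) := by
  classical
  let pj : Bool → ℕ → Fin n → Bool ⊕ (ℕ × Var) := fun o j i =>
    if o = true then ar.pb j i else ar.mu j (sr q (ar.dir j) i)
  have pjt : ∀ j i, pj true j i = ar.pb j i := fun j i => rfl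
  have pjf : ∀ j i, pj false j i = ar.mu j (sr q (ar.dir j) i) := fun j i => rfl
  let F : Bool → C → ZMod 3 → ℕ → (Fin n → E × Tg Var C V) := fun o c t j i =>
    elx X lab c t (T (t + ar.lev j) i) (pj o j i)
  have FE : ∀ o c t j i, F o c t j i = elx X lab c t (T (t + ar.lev j) i) (pj o j i) :=
    fun _ _ _ _ _ => rfl
  clear_value F pj
  have hvt : ∀ {j}, Val ar.N true j ↔ j ≤ ar.N := by simp [Val]
  have hvf : ∀ {j}, Val ar.N false j ↔ j < ar.N := by simp [Val]
  have hvle : ∀ {o j}, Val ar.N o j → j ≤ ar.N := by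
    intro o j h; cases o
    · exact (hvf.1 h).le
    · exact hvt.1 h
  have h1 : ∀ c t j, j < ar.N → keyEq l (F false c t j) (F true c t j) := by
    intro c t j hj p hp
    rw [FE, FE, pjt, pjf, ar.glue j hj p hp]
  have h1' : ∀ o c t j, Val ar.N o j → keyEq l (F o c t j) (F true c t j) := by
    intro o c t j h; cases o
    · exact h1 c t j (hvf.1 h)
    · exact fun _ _ => rfl
  have hXm : ∀ {t i}, T 0 i ∈ X → T t i ∈ X := fun h => (hX _ _).2 h
  have hXn : ∀ {t i}, T 0 i ∉ X → T t i ∉ X := fun h h' => h ((hX _ _).1 h')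
  -- levels
  have lvk : ∀ {o c t j o' c' t' j'}, keyEq l (F o c t j) (F o' c' t' j') →
      t + ar.lev j = t' + ar.lev j' := by
    intro o c t j o' c' t' j' h
    refine hT _ _ fun p hp => ?_
    have := congrArg Prod.fst (h p hp)
    rwa [FE, FE, elx_fst, elx_fst] at this
  have lvs : ∀ {o c t j o' c' t' j'}, solPair q (F o c t j) (F o' c' t' j') →
      t + ar.lev j + 1 = t' + ar.lev j' := by
    intro o c t j o' c' t' j' ⟨μ, m1, m2⟩
    refine hT _ _ ?_
    refine detA hq (a := T (t + ar.lev j)) ⟨β _, hA _, hB _⟩ ⟨fun v => (μ v).1, fun i => ?_, fun i => ?_⟩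
    · show (μ (q.1 i)).1 = _
      rw [m1, FE, elx_fst]
    · show (μ (q.2 i)).1 = _
      rw [m2, FE, elx_fst]
  -- solutions
  have St : ∀ c t e, ar.dir e = true → solPair q (F false c t e) (F true c t (e+1)) := by
    intro c t e he
    refine ⟨fun v => elx X lab c t (β (t + ar.lev e) v) (ar.mu e v), fun i => ?_, fun i => ?_⟩
    · simp [FE, pjf, he, sr, hA]
    · simp [FE, pjt, he, sr, hB, ar.pbS, ar.levS, add_assoc]
  have Sf : ∀ c t e, ar.dir e = false → solPair q (F true c t (e+1)) (F false c t e) := by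
    intro c t e he
    refine ⟨fun v => elx X lab c t (β (t + ar.lev (e+1)) v) (ar.mu e v), fun i => ?_, fun i => ?_⟩
    · simp [FE, pjt, he, sr, hA, ar.pbS]
    · simp [FE, pjf, he, sr, hB, ar.levS, add_assoc]
  have h3 : ∀ c t j, j < ar.N → solPair q (F false c t j) (F true c t (j+1)) ∨
      solPair q (F true c t (j+1)) (F false c t j) := by
    intro c t j _
    cases h : ar.dir j
    · exact Or.inr (Sf c t j h)
    · exact Or.inl (St c t j h)
  have h3' : ∀ c t, solPair q (F true c t 0) (F true c (t+1) 0) := by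
    intro c t
    refine ⟨fun v => (β t v, if β t v ∈ X then some (Sum.inl c) else none), fun i => ?_, fun i => ?_⟩
    · simp [FE, pjt, ar.pb0, ar.lev0, hA, elx]
    · simp [FE, pjt, ar.pb0, ar.lev0, hB, elx]
  have h1N : ∀ c t c' t', lab c t = lab c' t' → keyEq l (F true c t ar.N) (F true c' t' ar.N) := by
    intro c t c' t' h p hp
    have ht := hlab _ _ _ _ h
    subst ht
    rw [FE, FE, pjt, ar.Lpb _ le_rfl ar.privN p hp]
    by_cases hx : T 0 p ∈ X
    · rw [ar.Lend p hp hx]; simp [elx, h]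
    · exact elx_none (hXn hx) _ _
  -- private element uniqueness
  have prv : ∀ o j p' r (j0 : ℕ), Val ar.N o j → pj o j p' = Sum.inr r →
      (∀ e, e < ar.N → ∀ v, ar.mu e v = Sum.inr r → e = j0 ∨ e + 1 = j0) →
      (o = true ∧ (j = j0 ∨ j = j0 + 1)) ∨ (o = false ∧ (j = j0 ∨ j + 1 = j0)) := by
    intro o j p' r j0 hv hp hm
    cases o
    · right
      rw [pjf] at hp
      exact ⟨rfl, hm j (hvf.1 hv) _ hp⟩
    · left
      rw [pjt] at hp
      refine ⟨rfl, ?_⟩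
      cases j with
      | zero => rw [ar.pb0] at hp; simp at hp
      | succ e =>
        rw [ar.pbS] at hp
        have := hm e (by have := hvt.1 hv; omega) _ hp
        omega
  have kp : ∀ {o c t j o' c' t' j'}, Val ar.N o j → Val ar.N o' j' → ar.priv j →
      keyEq l (F o c t j) (F o' c' t' j') → c = c' ∧ t = t' ∧ j = j' := by
    intro o c t j o' c' t' j' hv hv' hp h
    have hjN : j < ar.N := by
      rcases (hvle hv).lt_or_eq with h | h
      · exact h
      · exact absurd (h ▸ hp) ar.privN
    obtain ⟨p, r, hpl, hr, hu⟩ := ar.privEl j hjN hp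
    have hk := keyEq_trans' (keyEq_symm' (h1' o c t j hv)) (keyEq_trans' h (h1' o' c' t' j' hv')) p hpl
    rw [FE, FE, pjt, hr] at hk
    obtain ⟨rfl, rfl, hk2⟩ := elx_inr hk
    refine ⟨rfl, rfl, ?_⟩
    have hjN' : j' < ar.N := by
      rcases (hvle hv').lt_or_eq with h | h
      · exact h
      · subst h
        rw [pjt, ar.Lpb _ le_rfl ar.privN p hpl] at hk2
        simp at hk2
    have a1 := prv true j' p r j (hvt.2 hjN'.le) hk2 hu
    have hk' : pj false j' p = Sum.inr r := by
      rw [pjf, ← hk2, pjt, ar.glue j' hjN' p hpl]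
    have a2 := prv false j' p r j (hvf.2 hjN') hk' hu
    simp at a1 a2
    omega
  have ckey : ∀ {o c t j}, Val ar.N o j → ¬ ar.priv j → ∀ p : Fin n, (p:ℕ) < l →
      F o c t j p = elx X lab c t (T (t + ar.lev j) p) (Sum.inl (ar.Lk j p)) := by
    intro o c t j hv hp p hpl
    rw [h1' o c t j hv p hpl, FE, pjt, ar.Lpb j (hvle hv) hp p hpl]
  have knF : ∀ {o c t j o' c' t' j'}, Val ar.N o j → Val ar.N o' j' → ¬ ar.priv j → ¬ ar.priv j' →
      j < ar.N →
      keyEq l (F o c t j) (F o' c' t' j') → c = c' ∧ t = t' ∧ j = j' := by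
    intro o c t j o' c' t' j' hv hv' hp hp' hj h
    obtain ⟨p, hpl, hY, hL⟩ := ar.Lfalse j hj hp
    have hk := h p hpl
    rw [ckey hv hp p hpl, ckey hv' hp' p hpl, hL] at hk
    obtain ⟨rfl, _⟩ := elx_false (hXm hY) hk
    have hjj : j = j' := by
      refine ar.Linj j j' (hvle hv) (hvle hv') hp hp' fun p hpl => ?_
      have hk := h p hpl
      rw [ckey hv hp p hpl, ckey hv' hp' p hpl] at hk
      by_cases hx : T 0 p ∈ X
      · cases hL : ar.Lk j p
        · rw [hL] at hk
          have := (elx_false (hXm hx) hk).2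
          simpa using this.symm
        · rw [hL] at hk
          have := (elx_true (hXm hx) hk).2
          simpa using this.symm
      · have a : ¬ ar.Lk j p = true := fun h => hx (ar.LY j (hvle hv) hp p hpl h)
        have b : ¬ ar.Lk j' p = true := fun h => hx (ar.LY j' (hvle hv') hp' p hpl h)
        simp at a b
        rw [a, b]
    subst hjj
    exact ⟨rfl, by simpa using lvk h, rfl⟩
  have h2 : ∀ o c t j o' c' t' j', Val ar.N o j → Val ar.N o' j' →
      keyEq l (F o c t j) (F o' c' t' j') →
      (c = c' ∧ t = t' ∧ j = j') ∨ (j = ar.N ∧ j' = ar.N ∧ lab c t = lab c' t') := by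
    intro o c t j o' c' t' j' hv hv' h
    by_cases hp : ar.priv j
    · exact Or.inl (kp hv hv' hp h)
    by_cases hp' : ar.priv j'
    · obtain ⟨a, b, c⟩ := kp hv' hv hp' (keyEq_symm' h)
      exact Or.inl ⟨a.symm, b.symm, c.symm⟩
    rcases (hvle hv).lt_or_eq with hj | hj
    · exact Or.inl (knF hv hv' hp hp' hj h)
    rcases (hvle hv').lt_or_eq with hj' | hj'
    · obtain ⟨a, b, c⟩ := knF hv' hv hp' hp hj' (keyEq_symm' h)
      exact Or.inl ⟨a.symm, b.symm, c.symm⟩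
    · right
      refine ⟨hj, hj', ?_⟩
      obtain ⟨p, hpl, hY, hL⟩ := ar.Ltrue j (by rw [hj]; exact ar.hN) (hvle hv) hp
      have hk := h p hpl
      rw [ckey hv hp p hpl, ckey hv' hp' p hpl, hL] at hk
      exact (elx_true (hXm hY) hk).1
  have h2j : ∀ {o c t j o' c' t' j'}, Val ar.N o j → Val ar.N o' j' →
      keyEq l (F o c t j) (F o' c' t' j') → j = j' := by
    intro o c t j o' c' t' j' hv hv' h
    rcases h2 _ _ _ _ _ _ _ _ hv hv' h with h | h
    · exact h.2.2
    · rw [h.1, h.2.1]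
  have plt : ∀ {o j}, Val ar.N o j → ar.priv j → j < ar.N := by
    intro o j hv hp
    rcases (hvle hv).lt_or_eq with h | h
    · exact h
    · exact absurd (h ▸ hp) ar.privN
  have ppos : ∀ {j}, ar.priv j → ∃ i, j = i + 1 := by
    intro j hp
    cases j with
    | zero => exact absurd hp ar.priv0
    | succ i => exact ⟨i, rfl⟩
  have z31 : ∀ x : ZMod 3, x + 1 ≠ x := by decide
  have z3s : ∀ x y : ZMod 3, x + (y + 1) + 1 ≠ x + y := by decide
  have z3m : ∀ x y : ZMod 3, x + y + 1 ≠ x + (y + -1) := by decide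
  refine ⟨F, h1, h1N, h2, h3, h3', ?_⟩
  intro o c t j o' c' t' j' hv hv' hoo hoo' hs
  have hsv : ∀ i, ∀ i', q.1 i = q.2 i' → F o c t j i = F o' c' t' j' i' := by
    obtain ⟨μ, m1, m2⟩ := hs
    intro i i' h
    rw [← m1, ← m2, h]
  by_cases hp' : ar.priv j'
  · have hjN' := plt hv' hp'
    obtain ⟨p, r, hpl, hr, hu⟩ := ar.privEl j' hjN' hp'
    obtain ⟨p', hk⟩ := det_vars2 hq hs p hpl
    rw [h1' o' c' t' j' hv' p hpl, FE, FE, pjt, hr] at hk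
    obtain ⟨rfl, rfl, hk2⟩ := elx_inr hk
    have ho := hoo rfl rfl
    subst ho
    have hl := lvs hs
    rcases prv o j p' r j' hv hk2 hu with ⟨rfl, rfl | rfl⟩ | ⟨rfl, rfl | rfl⟩
    · exact z31 _ hl
    · rw [ar.levS] at hl
      cases hd : ar.dir j'
      · obtain ⟨i, rfl⟩ := ppos hp'
        have := ar.turn i hjN' hp'
        rw [hd] at this
        have hdi : ar.dir i = true := by simpa using this
        have := h2j hv (hvf.2 (by omega)) (detB hq hs (St c' t' i hdi))
        omega
      · rw [if_pos hd] at hl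
        exact z3s _ _ hl
    · exact z31 _ hl
    · rw [ar.levS] at hl
      cases hd : ar.dir j
      · rw [hd] at hl
        exact z3m _ _ (by simpa using hl)
      · have := ar.turn j hjN' hp'
        rw [hd] at this
        have := h2j hv (hvt.2 (by omega)) (detB hq hs (Sf c' t' _ (by simpa using this)))
        omega
  by_cases hp : ar.priv j
  · have hjN := plt hv hp
    obtain ⟨p, r, hpl, hr, hu⟩ := ar.privEl j hjN hp
    obtain ⟨p', hk⟩ := det_vars1 hq hs p hpl
    rw [h1' o c t j hv p hpl, FE, FE, pjt, hr] at hk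
    obtain ⟨rfl, rfl, hk2⟩ := elx_inr hk
    have ho := hoo rfl rfl
    subst ho
    have hl := lvs hs
    rcases prv o j' p' r j hv' hk2 hu with ⟨rfl, rfl | rfl⟩ | ⟨rfl, rfl | rfl⟩
    · exact z31 _ hl
    · rw [ar.levS] at hl
      cases hd : ar.dir j
      · rw [hd] at hl
        exact z3m _ _ (by simpa using hl)
      · obtain ⟨i, rfl⟩ := ppos hp
        have := ar.turn i hjN hp
        rw [hd] at this
        have hdi : ar.dir i = false := by simpa using this
        have := h2j hv' (hvf.2 (by omega)) (detA hq hs (Sf c t i hdi))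
        omega
    · exact z31 _ hl
    · rw [ar.levS] at hl
      cases hd : ar.dir j'
      · have := ar.turn j' hjN hp
        rw [hd] at this
        have := h2j hv' (hvt.2 (by omega)) (detA hq hs (St c t _ (by simpa using this)))
        omega
      · rw [if_pos hd] at hl
        exact z3s _ _ hl
  have hNpos := ar.hN
  by_cases hC1 : o = true ∧ j = 0
  · obtain ⟨rfl, rfl⟩ := hC1
    have hk := detA hq hs (h3' c t)
    rcases h2 _ _ _ _ _ _ _ _ hv' (hvt.2 (Nat.zero_le _)) hk with ⟨rfl, rfl, rfl⟩ | h
    · cases o'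
      · cases hd : ar.dir 0
        · have := h2j hv (hvt.2 (by omega)) (detB hq hs (Sf c' (t+1) 0 hd))
          omega
        · obtain ⟨p, ⟨p', hpp⟩, r, hr⟩ := ar.first
          have := hsv p' p (by simpa [hd, sr] using hpp)
          rw [FE, FE, pjf, hr] at this
          have := (elx_inr this.symm).2.2
          rw [pjt, ar.pb0] at this
          simp at this
      · exact hoo' rfl (fun h => z31 _ h.symm) ⟨rfl, rfl⟩
    · omega
  by_cases hC2 : o' = true ∧ j' = 0
  · obtain ⟨rfl, rfl⟩ := hC2
    have h3c := h3' c' (t' - 1)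
    rw [sub_add_cancel] at h3c
    have hk := detB hq hs h3c
    rcases h2 _ _ _ _ _ _ _ _ hv (hvt.2 (Nat.zero_le _)) hk with ⟨rfl, htt, rfl⟩ | h
    · cases o
      · cases hd : ar.dir 0
        · obtain ⟨p, ⟨p', hpp⟩, r, hr⟩ := ar.first
          have := hsv p p' (by simpa [hd, sr] using hpp.symm)
          rw [FE, FE, pjf, hr] at this
          have := (elx_inr this).2.2
          rw [pjt, ar.pb0] at this
          simp at this
        · have := h2j hv' (hvt.2 (by omega)) (detA hq hs (St c t 0 hd))
          omega
      · exact hC1 ⟨rfl, rfl⟩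
    · omega
  have ru : (o = false → ar.dir j = false) ∧ (o = true → ∀ i, j = i + 1 → ar.dir i = true) := by
    constructor
    · rintro rfl
      cases hd : ar.dir j
      · rfl
      · have hjN := hvf.1 hv
        have := h2j hv' (hvt.2 (by omega)) (detA hq hs (St c t j hd))
        subst this
        rcases ar.alt j hjN with h | h
        · exact absurd h hp
        · exact absurd h hp'
    · rintro rfl i rfl
      cases hd : ar.dir i
      · have hjN := hvt.1 hv
        have := h2j hv' (hvf.2 (by omega)) (detA hq hs (Sf c t i hd))
        subst this
        rcases ar.alt j' (by omega) with h | h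
        · exact absurd h hp'
        · exact absurd h hp
      · rfl
  have rv : (o' = false → ar.dir j' = true) ∧ (o' = true → ∀ i, j' = i + 1 → ar.dir i = false) := by
    constructor
    · rintro rfl
      cases hd : ar.dir j'
      · have hjN := hvf.1 hv'
        have := h2j hv (hvt.2 (by omega)) (detB hq hs (Sf c' t' j' hd))
        subst this
        rcases ar.alt j' hjN with h | h
        · exact absurd h hp'
        · exact absurd h hp
      · rfl
    · rintro rfl i rfl
      cases hd : ar.dir i
      · rfl
      · have hjN := hvt.1 hv'
        have := h2j hv (hvf.2 (by omega)) (detB hq hs (St c' t' i hd))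
        subst this
        rcases ar.alt j (by omega) with h | h
        · exact absurd h hp
        · exact absurd h hp'
  have hl := lvs hs
  have tt1 : 0 < j → t = t' := by
    intro h
    obtain ⟨p, hpl, hY, hL⟩ := ar.Ltrue j h (hvle hv) hp
    obtain ⟨p', hk⟩ := det_vars1 hq hs p hpl
    rw [ckey hv hp p hpl, FE, hL] at hk
    exact hlab _ _ _ _ (elx_true (hXm hY) hk).1
  have tt2 : 0 < j' → t = t' := by
    intro h
    obtain ⟨p, hpl, hY, hL⟩ := ar.Ltrue j' h (hvle hv') hp'
    obtain ⟨p', hk⟩ := det_vars2 hq hs p hpl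
    rw [ckey hv' hp' p hpl, FE, hL] at hk
    exact (hlab _ _ _ _ (elx_true (hXm hY) hk).1).symm
  have tt : t = t' := by
    by_cases h : 0 < j
    · exact tt1 h
    by_cases h' : 0 < j'
    · exact tt2 h'
    obtain rfl : j = 0 := by omega
    obtain rfl : j' = 0 := by omega
    cases o
    · cases o'
      · have a := ru.1 rfl
        have b := rv.1 rfl
        rw [a] at b
        simp at b
      · exact absurd ⟨rfl, rfl⟩ hC2
    · exact absurd ⟨rfl, rfl⟩ hC1
  subst tt
  have hjj : j ≠ j' := by
    rintro rfl
    exact z31 _ hl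
  have cc : c = c' := by
    by_cases h : j < ar.N
    · obtain ⟨p, hpl, hY, hL⟩ := ar.Lfalse j h hp
      obtain ⟨p', hk⟩ := det_vars1 hq hs p hpl
      rw [ckey hv hp p hpl, FE, hL] at hk
      exact (elx_false (hXm hY) hk).1
    · have := hvle hv
      have := hvle hv'
      obtain ⟨p, hpl, hY, hL⟩ := ar.Lfalse j' (by omega) hp'
      obtain ⟨p', hk⟩ := det_vars2 hq hs p hpl
      rw [ckey hv' hp' p hpl, FE, hL] at hk
      exact (elx_false (hXm hY) hk).1.symm
  subst cc
  have ho := hoo rfl rfl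
  subst ho
  have hadj : AdjN l q (fun v => β 0 v ∈ X) (ar.Lk j) (ar.Lk j') := by
    obtain ⟨μ, m1, m2⟩ := hs
    refine ⟨fun v => decide ((∃ x, (μ v).2 = some (Sum.inr (Sum.inl x))) ∧ β 0 v ∈ X), ?_,
      Or.inl ⟨?_, ?_⟩⟩
    · intro v hv
      exact (of_decide_eq_true hv).2
    · intro p hpl
      simp only [m1, ckey hv hp p hpl, hA]
      have hLY := ar.LY j (hvle hv) hp p hpl
      cases hL : ar.Lk j p
      · symm
        rw [decide_eq_false_iff_not]
        rintro ⟨⟨x, hx⟩, h0⟩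
        simp [elx, hXm h0] at hx
      · symm
        rw [decide_eq_true_eq]
        exact ⟨⟨lab c t, by simp [elx, hXm (hLY hL)]⟩, hLY hL⟩
    · intro p hpl
      simp only [m2, ckey hv' hp' p hpl, hB]
      have hLY := ar.LY j' (hvle hv') hp' p hpl
      cases hL : ar.Lk j' p
      · symm
        rw [decide_eq_false_iff_not]
        rintro ⟨⟨x, hx⟩, h0⟩
        simp [elx, hXm ((hX _ _).1 h0)] at hx
      · symm
        rw [decide_eq_true_eq]
        exact ⟨⟨lab c t, by simp [elx, hXm (hLY hL)]⟩, hXm (hLY hL)⟩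
  rcases lt_or_gt_of_ne hjj with hlt | hlt
  · rcases ar.Ladj j j' hlt (hvle hv') hp hp' hadj with h | ⟨h, h'⟩
    · rw [h] at hl
      exact z31 _ hl
    · cases hd : ar.dir j
      · rw [h', hd] at hl
        exact z3m _ _ (by simpa using hl)
      · cases o
        · have := ru.1 rfl
          rw [hd] at this
          simp at this
        · have := rv.2 rfl (j'-1) (by omega)
          rw [h, hd] at this
          simp at this
  · rcases ar.Ladj j' j hlt (hvle hv) hp' hp (AdjN_symm hadj) with h | ⟨h, h'⟩
    · rw [h] at hl
      exact z31 _ hl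
    · cases hd : ar.dir j'
      · cases o
        · have := rv.1 rfl
          rw [hd] at this
          simp at this
        · have := ru.2 rfl (j-1) (by omega)
          rw [h, hd] at this
          simp at this
      · rw [h', if_pos hd] at hl
        exact z3s _ _ hl

end Main

lemma solPair_inj {n : ℕ} {Var G E : Type} [Nonempty G] {q : Query n Var} {f : G → E}
    (hf : Function.Injective f) {a b : Fin n → G} :
    solPair q (fun i => f (a i)) (fun i => f (b i)) ↔ solPair q a b := by
  constructor
  · rintro ⟨μ, h1, h2⟩
    refine ⟨fun v => Function.invFun f (μ v), fun i => ?_, fun i => ?_⟩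
    · show Function.invFun f (μ (q.1 i)) = _
      rw [h1, Function.leftInverse_invFun hf]
    · show Function.invFun f (μ (q.2 i)) = _
      rw [h2, Function.leftInverse_invFun hf]
  · rintro ⟨μ, h1, h2⟩
    exact ⟨fun v => f (μ v), fun i => by simp only [h1], fun i => by simp only [h2]⟩

lemma keyEq_inj {l n : ℕ} {G E : Type} {f : G → E}
    (hf : Function.Injective f) {a b : Fin n → G} :
    keyEq l (fun i => f (a i)) (fun i => f (b i)) ↔ keyEq l a b :=
  ⟨fun h i hi => hf (h i hi), fun h i hi => congrArg f (h i hi)⟩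

end CQA

/-- for a 2way-determined query admitting a triangle-tripath, no level `k`
of the greedy fixpoint algorithm computes `certain(q)`. -/
theorem triangle_tripath_delta_incomplete (n l : ℕ) (hn : 1 ≤ n) (hl : l ≤ n)
    (Elem Var : Type) [Countable Elem] [Infinite Elem] [Countable Var] [Infinite Var]
    (q : CQA.Query n Var) (hq : CQA.TwoWayDet l q)
    (ht : CQA.AdmitsTriangleTripath l q Elem)
    (k : ℕ) (hk : 1 ≤ k) :
    ∃ D : Set (Fin n → Elem), D.Finite ∧ CQA.Certain l q D ∧
      ∅ ∉ CQA.Delta l k q D := by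
  classical
  obtain ⟨T, β, X, hA, hB, hT, hX, hex, hwalk⟩ := CQA.layerB0 q ht
  obtain ⟨ar⟩ := CQA.arm_exists hq (Y := fun i => T 0 i ∈ X) (YV := fun v => β 0 v ∈ X)
    (by
      intro w i h
      cases w
      · have h' : β 0 (q.2 i) ∈ X := h
        rw [hB] at h'
        exact (hX _ _).1 h'
      · have h' : β 0 (q.1 i) ∈ X := h
        rw [hA] at h'
        exact h') hex hwalk
    (by
      intro i _ hY
      simpa using hY)
  obtain ⟨C, V, _, _, lab, 𝓕, hlab, hcard, hne, hstrat⟩ := CQA.comb_star k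
  obtain ⟨F, h1, h1', h2, h3, h3', h4⟩ := CQA.layerB2 hq hA hB hT hX ar lab hlab
  have : Countable C := Finite.to_countable
  have : Countable V := Finite.to_countable
  have : Countable (ZMod 3) := Finite.to_countable
  let G := (Elem × Elem × Elem) × CQA.Tg Var C V
  have : Nonempty G := by
    obtain ⟨x⟩ := (inferInstance : Nonempty Elem)
    exact ⟨((x, x, x), none)⟩
  obtain ⟨f1, hf1⟩ := Countable.exists_injective_nat G
  let ι : G → Elem := fun g => Infinite.natEmbedding Elem (f1 g)
  have hι : Function.Injective ι := fun a b h => hf1 ((Infinite.natEmbedding Elem).injective h)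
  refine CQA.criterion ar.hN q lab hcard 𝓕 hne hstrat
    (fun o c t j i => ι (F o c t j i)) ?_ ?_ ?_ ?_ ?_ ?_
  · intro c t j hj
    exact (CQA.keyEq_inj hι).2 (h1 c t j hj)
  · intro c t c' t' h
    exact (CQA.keyEq_inj hι).2 (h1' c t c' t' h)
  · intro o c t j o' c' t' j' hv hv' h
    exact h2 o c t j o' c' t' j' hv hv' ((CQA.keyEq_inj hι).1 h)
  · intro c t j hj
    exact (h3 c t j hj).imp (CQA.solPair_inj hι).2 (CQA.solPair_inj hι).2
  · intro c t
    exact (CQA.solPair_inj hι).2 (h3' c t)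
  · intro o c t j o' c' t' j' hv hv' a b h
    exact h4 o c t j o' c' t' j' hv hv' a b ((CQA.solPair_inj hι).1 h)
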